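/- arXiv:1708.06224 — 2 statements merged into one kernel-verified Lean document; each statement's English description precedes it below -/
import Mathlib

section
/- Let U be a subgroup of GL(7,F₂) with |U| = 49, and let C be a set of 3-dimensional F₂-linear subspaces of F₂⁷, any two distinct members of which intersect in a subspace of dimension at most 1, such that C is invariant under every element of U. Then |C| ≤ 296. -/
/-- The ambient vector space `F₂⁷`. -/
abbrev V : Type := Fin 7 → ZMod 2

/-- `GL(7,F₂)` acts on the subspaces of `F₂⁷` by mapping each subspace to its image
under the associated linear automorphism. -/
noncomputable instance : MulAction (GL (Fin 7) (ZMod 2)) (Submodule (ZMod 2) V) where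
  smul M W := W.map (Matrix.mulVecLin (M : Matrix (Fin 7) (Fin 7) (ZMod 2)))
  one_smul W := by
    show W.map _ = W
    simp
  mul_smul M N W := by
    show W.map _ = (W.map _).map _
    rw [← Submodule.map_comp]
    simp [Matrix.mulVecLin_mul]

/-- `C` is a `(7,4;3)₂` constant dimension code: a set of `3`-dimensional subspaces of `F₂⁷`
any two distinct members of which intersect in a subspace of dimension at most `1`. -/
def IsCode (C : Set (Submodule (ZMod 2) V)) : Prop :=
  (∀ W ∈ C, Module.finrank (ZMod 2) W = 3) ∧
  ∀ W₁ ∈ C, ∀ W₂ ∈ C, W₁ ≠ W₂ → Module.finrank (ZMod 2) ↥(W₁ ⊓ W₂) ≤ 1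

open Pointwise in
/-- The automorphism group of `C`: the setwise stabilizer of `C` in `GL(7,F₂)`,
i.e. all `M` with `C · M = C`. -/
noncomputable def Aut (C : Set (Submodule (ZMod 2) V)) : Subgroup (GL (Fin 7) (ZMod 2)) :=
  MulAction.stabilizer (GL (Fin 7) (ZMod 2)) C

/-- `C` is invariant under every element of the subgroup `U` of `GL(7,F₂)`. -/
def Invariant (U : Subgroup (GL (Fin 7) (ZMod 2))) (C : Set (Submodule (ZMod 2) V)) : Prop :=
  ∀ M ∈ U, ∀ W ∈ C, M • W ∈ C

open Module Finset

/-- A model of `F₂⁷` on which a Sylow `7`-subgroup of `GL(7,F₂)` acts diagonally; `F` will be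
the field with eight elements. -/
abbrev Model (F : Type) : Type := F × F × ZMod 2

section Torus

variable {F : Type} [Field F] [Algebra (ZMod 2) F]

/-- The group `Fˣ × Fˣ` acts on `F × F × F₂` by scaling the first two components. -/
def torus : Fˣ × Fˣ →* (Model F ≃ₗ[ZMod 2] Model F) where
  toFun g := (DistribMulAction.toLinearEquiv (ZMod 2) F g.1).prodCongr
    ((DistribMulAction.toLinearEquiv (ZMod 2) F g.2).prodCongr (LinearEquiv.refl _ _))
  map_one' := by ext x <;> simp
  map_mul' g h := by ext x <;> simp [mul_smul]

@[simp]
lemma torus_apply (g : Fˣ × Fˣ) (x : Model F) :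
    torus g x = ((g.1 : F) * x.1, (g.2 : F) * x.2.1, x.2.2) := by
  simp [torus, Units.smul_def]

/-- Exchange of the two copies of `F`. -/
def swapEquiv : Model F ≃ₗ[ZMod 2] Model F where
  toFun x := (x.2.1, x.1, x.2.2)
  invFun x := (x.2.1, x.1, x.2.2)
  map_add' _ _ := rfl
  map_smul' _ _ := rfl
  left_inv _ := rfl
  right_inv _ := rfl

/-- The first copy of `F`. -/
def fstSpace (F : Type) [Field F] [Algebra (ZMod 2) F] : Submodule (ZMod 2) (Model F) :=
  LinearMap.ker (LinearMap.snd (ZMod 2) F (F × ZMod 2))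

/-- The second copy of `F`. -/
def sndSpace (F : Type) [Field F] [Algebra (ZMod 2) F] : Submodule (ZMod 2) (Model F) :=
  (fstSpace F).map (swapEquiv (F := F)).toLinearMap

lemma mem_fstSpace {x : Model F} : x ∈ fstSpace F ↔ x.2.1 = 0 ∧ x.2.2 = 0 := by
  simp [fstSpace, Prod.ext_iff]

lemma mem_map_swapEquiv {W : Submodule (ZMod 2) (Model F)} {x : Model F} :
    x ∈ W.map (swapEquiv (F := F)).toLinearMap ↔ (x.2.1, x.1, x.2.2) ∈ W :=
  Submodule.mem_map_equiv W

lemma mem_sndSpace {x : Model F} : x ∈ sndSpace F ↔ x.1 = 0 ∧ x.2.2 = 0 := by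
  rw [sndSpace, mem_map_swapEquiv, mem_fstSpace]

lemma map_swapEquiv_map_swapEquiv (W : Submodule (ZMod 2) (Model F)) :
    (W.map (swapEquiv (F := F)).toLinearMap).map (swapEquiv (F := F)).toLinearMap = W := by
  ext x
  simp only [mem_map_swapEquiv]

/-- A code in `F × F × F₂` that is invariant under `Fˣ × Fˣ`. -/
structure IsTorusCode (C : Finset (Submodule (ZMod 2) (Model F))) : Prop where
  finrank_eq : ∀ W ∈ C, finrank (ZMod 2) W = 3
  finrank_inf_le : ∀ W₁ ∈ C, ∀ W₂ ∈ C, W₁ ≠ W₂ → finrank (ZMod 2) ↥(W₁ ⊓ W₂) ≤ 1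
  map_mem : ∀ g : Fˣ × Fˣ, ∀ W ∈ C, W.map (torus g).toLinearMap ∈ C

open Classical in
/-- The image of a code under the exchange of the two copies of `F`. -/
noncomputable def swapCode (C : Finset (Submodule (ZMod 2) (Model F))) :
    Finset (Submodule (ZMod 2) (Model F)) :=
  C.image fun W => W.map (swapEquiv (F := F)).toLinearMap

lemma mem_swapCode {C : Finset (Submodule (ZMod 2) (Model F))}
    {W : Submodule (ZMod 2) (Model F)} :
    W ∈ swapCode C ↔ W.map (swapEquiv (F := F)).toLinearMap ∈ C := by
  simp only [swapCode, mem_image]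
  constructor
  · rintro ⟨W, hW, rfl⟩
    rwa [map_swapEquiv_map_swapEquiv]
  · exact fun h => ⟨_, h, map_swapEquiv_map_swapEquiv W⟩

lemma map_mem_swapCode {C : Finset (Submodule (ZMod 2) (Model F))}
    {W : Submodule (ZMod 2) (Model F)} (hW : W ∈ C) :
    W.map (swapEquiv (F := F)).toLinearMap ∈ swapCode C := by
  rwa [mem_swapCode, map_swapEquiv_map_swapEquiv]

lemma map_swapEquiv_injective :
    Function.Injective fun W : Submodule (ZMod 2) (Model F) =>
      W.map (swapEquiv (F := F)).toLinearMap :=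
  Function.LeftInverse.injective map_swapEquiv_map_swapEquiv

lemma IsTorusCode.swap {C : Finset (Submodule (ZMod 2) (Model F))} (hC : IsTorusCode C) :
    IsTorusCode (swapCode C) where
  finrank_eq W hW := by
    have := hC.finrank_eq _ (mem_swapCode.1 hW)
    rwa [LinearEquiv.finrank_map_eq] at this
  finrank_inf_le W₁ h₁ W₂ h₂ hne := by
    have := hC.finrank_inf_le _ (mem_swapCode.1 h₁) _ (mem_swapCode.1 h₂)
      (map_swapEquiv_injective.ne hne)
    rwa [← Submodule.map_inf _ (LinearEquiv.injective _), LinearEquiv.finrank_map_eq] at this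
  map_mem g W hW := by
    rw [mem_swapCode] at hW ⊢
    convert hC.map_mem g.swap _ hW using 1
    rw [← Submodule.map_comp, ← Submodule.map_comp]
    rfl

/-- The codewords other than the two invariant ones. -/
structure IsProper (C : Finset (Submodule (ZMod 2) (Model F)))
    (W : Submodule (ZMod 2) (Model F)) : Prop where
  mem : W ∈ C
  ne_fst : W ≠ fstSpace F
  ne_snd : W ≠ sndSpace F

lemma IsProper.swap {C : Finset (Submodule (ZMod 2) (Model F))}
    {W : Submodule (ZMod 2) (Model F)} (hW : IsProper C W) :
    IsProper (swapCode C) (W.map (swapEquiv (F := F)).toLinearMap) where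
  mem := map_mem_swapCode hW.mem
  ne_fst h := hW.ne_snd (by rw [sndSpace, ← h, map_swapEquiv_map_swapEquiv])
  ne_snd h := hW.ne_fst (map_swapEquiv_injective h)

lemma torus_pow_apply (g : Fˣ × Fˣ) (n : ℕ) (x : Model F) :
    torus (g ^ n) x = ((g.1 : F) ^ n * x.1, (g.2 : F) ^ n * x.2.1, x.2.2) := by
  rw [torus_apply]
  simp

lemma torus_pow_mem {W : Submodule (ZMod 2) (Model F)} {g : Fˣ × Fˣ}
    (h : ∀ z ∈ W, torus g z ∈ W) {z : Model F} (hz : z ∈ W) (n : ℕ) : torus (g ^ n) z ∈ W := by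
  induction n with
  | zero => simpa using hz
  | succ n ih =>
    rw [pow_succ', map_mul]
    exact h _ ih

end Torus

section Units

variable {F : Type} [Field F] [Fintype F]

lemma card_units (hF : Fintype.card F = 8) : Nat.card Fˣ = 7 := by
  rw [Nat.card_units, Nat.card_eq_fintype_card, hF]

lemma exists_unit_ne_one (hF : Fintype.card F = 8) : ∃ v : Fˣ, v ≠ 1 := by
  have : Nontrivial Fˣ := Finite.one_lt_card_iff_nontrivial.1 (by rw [card_units hF]; norm_num)
  exact exists_ne 1

lemma unit_eq_one_of_pow_eq_one (hF : Fintype.card F = 8) {u : Fˣ} {k : ℕ} (hk : 0 < k)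
    (hk3 : k ≤ 3) (h : u ^ k = 1) : u = 1 := by
  have h7 : u ^ 7 = 1 := by rw [← card_units hF]; exact pow_card_eq_one'
  have : Nat.gcd k 7 = 1 := by interval_cases k <;> rfl
  rw [← pow_one u, ← this]
  exact pow_gcd_eq_one.2 ⟨h, h7⟩

lemma card_erase_zero (hF : Fintype.card F = 8) [DecidableEq F] :
    ((univ : Finset F).erase 0).card = 7 := by
  rw [card_erase_of_mem (mem_univ _), card_univ, hF]

lemma ne_zero_of_affine {F : Type} [Field F] {x : Model F} (hx : x.2.2 = 1) : x ≠ 0 := by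
  rintro rfl
  exact zero_ne_one hx

lemma zmod_two_cases (e : ZMod 2) : e = 0 ∨ e = 1 := by
  revert e; decide

end Units

section Geometry

variable {F : Type} [Field F] [Fintype F] [Algebra (ZMod 2) F]

lemma finrank_eq_three (hF : Fintype.card F = 8) : finrank (ZMod 2) F = 3 := by
  have h := Module.card_eq_pow_finrank (K := ZMod 2) (V := F)
  rw [hF, ZMod.card] at h
  exact (Nat.pow_right_injective (le_refl 2) (a₁ := 3) h).symm

lemma finrank_model (hF : Fintype.card F = 8) : finrank (ZMod 2) (Model F) = 7 := by
  simp [finrank_eq_three hF]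

lemma finrank_fstSpace (hF : Fintype.card F = 8) : finrank (ZMod 2) (fstSpace F) = 3 := by
  have h := LinearMap.finrank_range_add_finrank_ker (LinearMap.snd (ZMod 2) F (F × ZMod 2))
  rw [LinearMap.range_eq_top.2 LinearMap.snd_surjective, finrank_top, finrank_model hF,
    finrank_prod, finrank_eq_three hF, finrank_self] at h
  exact Nat.add_left_cancel (n := 4) h

lemma finrank_sndSpace (hF : Fintype.card F = 8) : finrank (ZMod 2) (sndSpace F) = 3 := by
  rw [sndSpace, LinearEquiv.finrank_map_eq, finrank_fstSpace hF]

open Classical in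
/-- The vectors of `W` in the hyperplane `F × F × 0`. -/
noncomputable def hyperPart (W : Submodule (ZMod 2) (Model F)) : Finset (Model F) :=
  univ.filter fun x => x ∈ W ∧ x.2.2 = 0

open Classical in
/-- The vectors of `W` outside the hyperplane `F × F × 0`. -/
noncomputable def affinePart (W : Submodule (ZMod 2) (Model F)) : Finset (Model F) :=
  univ.filter fun x => x ∈ W ∧ x.2.2 = 1

@[simp]
lemma mem_hyperPart {W : Submodule (ZMod 2) (Model F)} {x : Model F} :
    x ∈ hyperPart W ↔ x ∈ W ∧ x.2.2 = 0 := by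
  simp [hyperPart]

@[simp]
lemma mem_affinePart {W : Submodule (ZMod 2) (Model F)} {x : Model F} :
    x ∈ affinePart W ↔ x ∈ W ∧ x.2.2 = 1 := by
  simp [affinePart]

lemma card_affinePart_eq {W : Submodule (ZMod 2) (Model F)} {z : Model F} (hz : z ∈ W)
    (hz1 : z.2.2 = 1) : (affinePart W).card = (hyperPart W).card := by
  refine Finset.card_bij' (fun x _ => x - z) (fun x _ => x + z) ?_ ?_ ?_ ?_
  · intro x hx
    rw [mem_affinePart] at hx
    simp [W.sub_mem hx.1 hz, hx.2, hz1]
  · intro x hx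
    rw [mem_hyperPart] at hx
    simp [W.add_mem hx.1 hz, hx.2, hz1]
  · simp
  · simp

lemma disjoint_hyperPart_affinePart (W : Submodule (ZMod 2) (Model F)) :
    Disjoint (hyperPart W) (affinePart W) := by
  rw [Finset.disjoint_left]
  intro x hx hx'
  rw [mem_hyperPart] at hx
  rw [mem_affinePart] at hx'
  exact zero_ne_one (hx.2.symm.trans hx'.2)

open Classical in
lemma card_hyperPart_add (W : Submodule (ZMod 2) (Model F)) (hW : finrank (ZMod 2) W = 3) :
    (hyperPart W).card + (affinePart W).card = 8 := by
  have h := Module.card_eq_pow_finrank (K := ZMod 2) (V := W)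
  rw [hW, ZMod.card] at h
  rw [← card_union_of_disjoint]
  · have : hyperPart W ∪ affinePart W = univ.filter (· ∈ W) := by
      ext x
      have := zmod_two_cases x.2.2
      simp only [mem_union, mem_hyperPart, mem_affinePart, mem_filter, mem_univ, true_and]
      tauto
    rw [this, ← Fintype.card_subtype]
    simpa using h
  · exact disjoint_hyperPart_affinePart W

lemma four_le_card_hyperPart (W : Submodule (ZMod 2) (Model F)) (hW : finrank (ZMod 2) W = 3) :
    4 ≤ (hyperPart W).card := by
  have h := card_hyperPart_add W hW
  rcases (affinePart W).eq_empty_or_nonempty with h0 | ⟨z, hz⟩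
  · rw [h0, card_empty] at h
    omega
  · rw [mem_affinePart] at hz
    have := card_affinePart_eq hz.1 hz.2
    omega

lemma exists_mem_notMem (W : Submodule (ZMod 2) (Model F)) (hW : finrank (ZMod 2) W = 3)
    (s : Finset (Model F)) (hs : s.card < 8) : ∃ z ∈ W, z ∉ s := by
  classical
  by_contra! hcon
  have hsub : hyperPart W ∪ affinePart W ⊆ s := by
    intro x hx
    simp only [mem_union, mem_hyperPart, mem_affinePart] at hx
    exact hcon x (by tauto)
  have := card_le_card hsub
  rw [card_union_of_disjoint (disjoint_hyperPart_affinePart W), card_hyperPart_add W hW] at this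
  omega

lemma exists_hyperPart_ne_zero {W : Submodule (ZMod 2) (Model F)}
    (hW : finrank (ZMod 2) W = 3) : ∃ p ∈ W, p.2.2 = 0 ∧ p ≠ 0 := by
  have h : ({0} : Finset (Model F)).card < (hyperPart W).card := by
    have := four_le_card_hyperPart W hW
    simp
    omega
  obtain ⟨p, hp, hp0⟩ := Finset.exists_mem_notMem_of_card_lt_card h
  rw [mem_hyperPart] at hp
  exact ⟨p, hp.1, hp.2, by simpa using hp0⟩

variable {C : Finset (Submodule (ZMod 2) (Model F))} {W : Submodule (ZMod 2) (Model F)}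

/-- Two codewords with two common points are equal. -/
lemma IsTorusCode.eq_of_mem (hC : IsTorusCode C) {W' : Submodule (ZMod 2) (Model F)}
    (hW : W ∈ C) (hW' : W' ∈ C) {x y : Model F} (hx : x ∈ W) (hx' : x ∈ W') (hy : y ∈ W)
    (hy' : y ∈ W') (hx0 : x ≠ 0) (hy0 : y ≠ 0) (hxy : x ≠ y) : W = W' := by
  classical
  by_contra hne
  have h1 := hC.finrank_inf_le W hW W' hW' hne
  have h2 := Module.card_eq_pow_finrank (K := ZMod 2) (V := ↥(W ⊓ W'))
  rw [ZMod.card] at h2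
  have h3 : 2 ^ finrank (ZMod 2) ↥(W ⊓ W') ≤ 2 ^ 1 := Nat.pow_le_pow_right (by norm_num) h1
  have h4 : ({0, x, y} : Finset (Model F)).card ≤ Fintype.card ↥(W ⊓ W') := by
    rw [Fintype.card_subtype]
    apply card_le_card
    intro z hz
    simp only [mem_insert, mem_singleton] at hz
    rcases hz with rfl | rfl | rfl <;> simp [*]
  rw [card_eq_three.2 ⟨0, x, y, hx0.symm, hy0.symm, hxy, rfl⟩] at h4
  omega

/-- A codeword that shares two points with its image under `g` is stable under `g`. -/
lemma IsTorusCode.stable_of_mem (hC : IsTorusCode C) (hW : W ∈ C) {g : Fˣ × Fˣ}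
    {x y : Model F} (hx : x ∈ W) (hgx : torus g x ∈ W) (hy : y ∈ W) (hgy : torus g y ∈ W)
    (hx0 : x ≠ 0) (hy0 : y ≠ 0) (hxy : x ≠ y) : ∀ z ∈ W, torus g z ∈ W := by
  have h := hC.eq_of_mem hW (hC.map_mem g W hW) hgx (Submodule.mem_map_of_mem hx) hgy
    (Submodule.mem_map_of_mem hy) ((torus g).map_ne_zero_iff.2 hx0)
    ((torus g).map_ne_zero_iff.2 hy0) ((torus g).injective.ne hxy)
  intro z hz
  rw [h]
  exact Submodule.mem_map_of_mem hz

lemma finrank_ker_snd_fst (hF : Fintype.card F = 8) :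
    finrank (ZMod 2) (LinearMap.ker
      (LinearMap.fst (ZMod 2) F (ZMod 2) ∘ₗ LinearMap.snd (ZMod 2) F (F × ZMod 2))) = 4 := by
  have h := LinearMap.finrank_range_add_finrank_ker
    (LinearMap.fst (ZMod 2) F (ZMod 2) ∘ₗ LinearMap.snd (ZMod 2) F (F × ZMod 2))
  rw [LinearMap.range_eq_top.2 fun b => ⟨(0, b, 0), rfl⟩,
    finrank_top, finrank_model hF, finrank_eq_three hF] at h
  omega

lemma IsTorusCode.eq_fstSpace_of_le (hC : IsTorusCode C) (hF : Fintype.card F = 8)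
    (hW : W ∈ C) (h : ∀ z ∈ W, z.2.1 = 0) : W = fstSpace F := by
  have hstab : ∀ u : Fˣ, W = W.map (torus (u, 1)).toLinearMap := by
    intro u
    by_contra hne
    have h1 := hC.finrank_inf_le W hW _ (hC.map_mem (u, 1) W hW) hne
    have h2 := Submodule.finrank_sup_add_finrank_inf_eq W (W.map (torus (u, 1)).toLinearMap)
    rw [hC.finrank_eq W hW, hC.finrank_eq _ (hC.map_mem (u, 1) W hW)] at h2
    have h3 : W ⊔ W.map (torus (u, 1)).toLinearMap ≤ LinearMap.ker
        (LinearMap.fst (ZMod 2) F (ZMod 2) ∘ₗ LinearMap.snd (ZMod 2) F (F × ZMod 2)) := by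
      refine sup_le (fun z hz => h z hz) ?_
      rintro _ ⟨z, hz, rfl⟩
      simp [h z hz]
    have h4 := Submodule.finrank_mono h3
    rw [finrank_ker_snd_fst hF] at h4
    omega
  obtain ⟨p, hp, hp0, hpne⟩ := exists_hyperPart_ne_zero (hC.finrank_eq W hW)
  have hp1 : p.1 ≠ 0 := fun h1 => hpne (by ext <;> simp [h1, h p hp, hp0])
  symm
  apply Submodule.eq_of_le_of_finrank_eq
  · intro x hx
    rw [mem_fstSpace] at hx
    by_cases hx1 : x.1 = 0
    · have : x = 0 := by ext <;> simp [hx1, hx.1, hx.2]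
      rw [this]
      exact W.zero_mem
    · rw [hstab (Units.mk0 (x.1 / p.1) (div_ne_zero hx1 hp1))]
      refine ⟨p, hp, ?_⟩
      ext <;> simp [h p hp, hp0, hx.1, hx.2, hp1]
  · rw [finrank_fstSpace hF, hC.finrank_eq W hW]

lemma IsTorusCode.eq_of_stable_snd (hC : IsTorusCode C) (hF : Fintype.card F = 8) (hW : W ∈ C)
    {v : Fˣ} (hv : v ≠ 1) (h : ∀ z ∈ W, torus (1, v) z ∈ W) :
    W = fstSpace F ∨ W = sndSpace F := by
  by_cases hz : ∀ z ∈ W, z.2.1 = 0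
  · exact Or.inl (hC.eq_fstSpace_of_le hF hW hz)
  right
  push Not at hz
  obtain ⟨z, hz, hz0⟩ := hz
  obtain ⟨c, hc, hc0⟩ : ∃ c : F, (0, c, 0) ∈ W ∧ c ≠ 0 := by
    refine ⟨((v : F) - 1) * z.2.1, ?_, mul_ne_zero (sub_ne_zero.2 (by simpa using hv)) hz0⟩
    have := W.sub_mem (h z hz) hz
    convert this using 1
    ext <;> simp [sub_mul]
  have hpow : ∀ n : ℕ, ((0, (v : F) ^ n * c, 0) : Model F) ∈ W := by
    intro n
    induction n with
    | zero => simpa using hc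
    | succ n ih => simpa [pow_succ', mul_assoc] using h _ ih
  symm
  apply Submodule.eq_of_le_of_finrank_eq
  · intro x hx
    rw [mem_sndSpace] at hx
    by_cases hx1 : x.2.1 = 0
    · have : x = 0 := by ext <;> simp [hx1, hx.1, hx.2]
      rw [this]
      exact W.zero_mem
    · have : Fact (Nat.Prime 7) := ⟨by norm_num⟩
      obtain ⟨n, hn⟩ := mem_powers_of_prime_card (card_units hF) hv
        (g' := Units.mk0 (x.2.1 / c) (div_ne_zero hx1 hc0))
      have hn' : (v : F) ^ n = x.2.1 / c := by
        simpa using congrArg (Units.val) hn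
      have := hpow n
      rw [hn', div_mul_cancel₀ _ hc0] at this
      convert this using 1
      ext <;> simp [hx.1, hx.2]
  · rw [finrank_sndSpace hF, hC.finrank_eq W hW]

lemma IsProper.eq_one_of_stable_snd (hW : IsProper C W) (hC : IsTorusCode C)
    (hF : Fintype.card F = 8) {v : Fˣ} (h : ∀ z ∈ W, torus (1, v) z ∈ W) : v = 1 := by
  by_contra hv
  rcases hC.eq_of_stable_snd hF hW.mem hv h with h | h
  · exact hW.ne_fst h
  · exact hW.ne_snd h

lemma IsProper.eq_one_of_stable_fst (hW : IsProper C W) (hC : IsTorusCode C)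
    (hF : Fintype.card F = 8) {u : Fˣ} (h : ∀ z ∈ W, torus (u, 1) z ∈ W) : u = 1 := by
  refine hW.swap.eq_one_of_stable_snd hC.swap hF fun z hz => ?_
  rw [mem_map_swapEquiv] at hz ⊢
  simpa using h _ hz

/-- A proper codeword has at most one point in the span of the first copy of `F` and the
invariant point. -/
lemma IsProper.eq_of_snd_eq_zero (hW : IsProper C W) (hC : IsTorusCode C)
    (hF : Fintype.card F = 8) {x y : Model F} (hx : x ∈ W) (hy : y ∈ W) (hx1 : x.2.1 = 0)
    (hy1 : y.2.1 = 0) (hx0 : x ≠ 0) (hy0 : y ≠ 0) : x = y := by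
  by_contra hxy
  obtain ⟨v, hv⟩ := exists_unit_ne_one hF
  refine hv (hW.eq_one_of_stable_snd hC hF (hC.stable_of_mem hW.mem hx ?_ hy ?_ hx0 hy0 hxy))
  · convert hx using 1
    ext <;> simp [hx1]
  · convert hy using 1
    ext <;> simp [hy1]

lemma IsProper.eq_of_fst_eq_zero (hW : IsProper C W) (hC : IsTorusCode C)
    (hF : Fintype.card F = 8) {x y : Model F} (hx : x ∈ W) (hy : y ∈ W) (hx1 : x.1 = 0)
    (hy1 : y.1 = 0) (hx0 : x ≠ 0) (hy0 : y ≠ 0) : x = y := by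
  apply (swapEquiv (F := F)).injective
  exact hW.swap.eq_of_snd_eq_zero hC.swap hF (Submodule.mem_map_of_mem hx)
    (Submodule.mem_map_of_mem hy) hx1 hy1 ((swapEquiv (F := F)).map_ne_zero_iff.2 hx0)
    ((swapEquiv (F := F)).map_ne_zero_iff.2 hy0)

/-- A proper codeword with a point in the span of the first copy of `F` and the invariant point
does not meet the second copy of `F`. -/
lemma IsProper.notMem_snd (hW : IsProper C W) (hC : IsTorusCode C)
    (hF : Fintype.card F = 8) {x : Model F} (hx : x ∈ W) (hx1 : x.2.1 = 0) (hx0 : x ≠ 0)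
    {b : F} (hb : ((0, b, 0) : Model F) ∈ W) : b = 0 := by
  classical
  by_contra hb0
  obtain ⟨z, hz, hzs⟩ := exists_mem_notMem W (hC.finrank_eq W hW.mem)
    {0, x, (0, b, 0), x + (0, b, 0)} (card_le_four.trans_lt (by norm_num))
  simp only [mem_insert, mem_singleton, not_or] at hzs
  obtain ⟨hz0, hzx, hzb, hzxb⟩ := hzs
  have hd : z.2.1 ≠ 0 := fun h => hzx (hW.eq_of_snd_eq_zero hC hF hz hx h hx1 hz0 hx0)
  have hdb : z.2.1 - b ≠ 0 := fun h =>
    hzxb (sub_eq_iff_eq_add.1 (hW.eq_of_snd_eq_zero hC hF (W.sub_mem hz hb) hx (by simpa using h)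
      hx1 (sub_ne_zero.2 hzb) hx0))
  have hv : Units.mk0 ((z.2.1 - b) / z.2.1) (div_ne_zero hdb hd) = 1 := by
    refine hW.eq_one_of_stable_snd hC hF
      (hC.stable_of_mem hW.mem hx ?_ hz ?_ hx0 hz0 (Ne.symm hzx))
    · convert hx using 1
      ext <;> simp [hx1]
    · convert W.sub_mem hz hb using 1
      ext <;> simp [hd]
  have := congrArg Units.val hv
  simp [div_eq_one_iff_eq hd] at this
  exact hb0 this

lemma IsProper.notMem_fst (hW : IsProper C W) (hC : IsTorusCode C)
    (hF : Fintype.card F = 8) {x : Model F} (hx : x ∈ W) (hx1 : x.1 = 0) (hx0 : x ≠ 0)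
    {a : F} (ha : ((a, 0, 0) : Model F) ∈ W) : a = 0 :=
  hW.swap.notMem_snd hC.swap hF (Submodule.mem_map_of_mem hx) hx1
    ((swapEquiv (F := F)).map_ne_zero_iff.2 hx0) (mem_map_swapEquiv.2 ha)

lemma IsProper.card_hyperPart (hW : IsProper C W) (hC : IsTorusCode C) {z : Model F}
    (hz : z ∈ W) (hz1 : z.2.2 = 1) : (hyperPart W).card = 4 ∧ (affinePart W).card = 4 := by
  have := card_hyperPart_add W (hC.finrank_eq W hW.mem)
  have := card_affinePart_eq hz hz1
  omega

/-- A codeword outside the hyperplane `F × F × 0` has trivial stabilizer. -/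
lemma IsProper.eq_one_of_stable (hW : IsProper C W) (hC : IsTorusCode C)
    (hF : Fintype.card F = 8) {z : Model F} (hz : z ∈ W) (hz1 : z.2.2 = 1) {g : Fˣ × Fˣ}
    (h : ∀ z ∈ W, torus g z ∈ W) : g = 1 := by
  classical
  obtain ⟨p, hp, hp0, hpne⟩ := exists_hyperPart_ne_zero (hC.finrank_eq W hW.mem)
  have hcard : ((hyperPart W).erase 0).card < (range 4).card := by
    rw [card_erase_of_mem (by simp), (hW.card_hyperPart hC hz hz1).1, card_range]
    norm_num
  obtain ⟨i, hi, j, hj, hij, heq⟩ := exists_ne_map_eq_of_card_lt_of_maps_to hcard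
    (f := fun n => torus (g ^ n) p) (by
      intro n _
      refine mem_coe.2 (mem_erase.2 ⟨(torus (g ^ n)).map_ne_zero_iff.2 hpne, ?_⟩)
      rw [mem_hyperPart]
      exact ⟨torus_pow_mem h hp n, by simpa only [torus_pow_apply] using hp0⟩)
  wlog hlt : i < j generalizing i j
  · exact this j hj i hi hij.symm heq.symm (by omega)
  rw [mem_range] at hi hj
  have hfix : torus (g ^ (j - i)) p = p := by
    apply (torus (g ^ i)).injective
    rw [← LinearEquiv.mul_apply, ← map_mul, ← pow_add, Nat.add_sub_cancel' hlt.le]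
    exact heq.symm
  rw [torus_pow_apply] at hfix
  obtain ⟨h1, h2, -⟩ := Prod.ext_iff.1 hfix |>.imp_right Prod.ext_iff.1
  obtain ⟨u, v⟩ := g
  by_cases hp1 : p.1 = 0
  · have hp2 : p.2.1 ≠ 0 := fun h2 => hpne (by ext <;> simp [hp1, h2, hp0])
    have hv : v = 1 := unit_eq_one_of_pow_eq_one hF (k := j - i) (by omega) (by omega)
      (by ext; simpa [hp2] using h2)
    subst hv
    rw [hW.eq_one_of_stable_fst hC hF h]
    rfl
  · have hu : u = 1 := unit_eq_one_of_pow_eq_one hF (k := j - i) (by omega) (by omega)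
      (by ext; simpa [hp1] using h1)
    subst hu
    rw [hW.eq_one_of_stable_snd hC hF h]
    rfl

/-- A proper codeword does not contain the invariant point. -/
lemma IsProper.invariant_point_notMem (hW : IsProper C W) (hC : IsTorusCode C)
    (hF : Fintype.card F = 8) : ((0, 0, 1) : Model F) ∉ W := by
  classical
  intro hl
  have hl0 : ((0, 0, 1) : Model F) ≠ 0 := by simp [Prod.ext_iff]
  obtain ⟨p, hp, hp0, hpne⟩ := exists_hyperPart_ne_zero (hC.finrank_eq W hW.mem)
  obtain ⟨q, hq, hqs⟩ : ∃ q ∈ hyperPart W, q ∉ ({0, p} : Finset (Model F)) := by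
    apply exists_mem_notMem_of_card_lt_card
    rw [(hW.card_hyperPart hC hl rfl).1]
    exact card_le_two.trans_lt (by norm_num)
  rw [mem_hyperPart] at hq
  simp only [mem_insert, mem_singleton, not_or] at hqs
  have hne : ∀ x ∈ W, x.2.2 = 0 → x ≠ 0 → x.1 ≠ 0 ∧ x.2.1 ≠ 0 := by
    intro x hx hx2 hx0
    constructor
    · intro h1
      have := hW.eq_of_fst_eq_zero hC hF hx hl h1 rfl hx0 hl0
      simp [this] at hx2
    · intro h1
      have := hW.eq_of_snd_eq_zero hC hF hx hl h1 rfl hx0 hl0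
      simp [this] at hx2
  have hpp := hne p hp hp0 hpne
  have hqq := hne q hq.1 hq.2 hqs.1
  have hgp : torus (Units.mk0 (q.1 / p.1) (div_ne_zero hqq.1 hpp.1),
      Units.mk0 (q.2.1 / p.2.1) (div_ne_zero hqq.2 hpp.2)) p = q := by
    ext <;> simp [hpp.1, hpp.2, hp0, hq.2]
  have hg := hW.eq_one_of_stable hC hF hl rfl (hC.stable_of_mem hW.mem hp
    (by rw [hgp]; exact hq.1) hl (by simpa using hl) hpne hl0
    (fun h => by simp [h] at hp0))
  rw [hg, map_one] at hgp
  exact hqs.2 hgp.symm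

end Geometry

section Counting

variable {F : Type} [Field F] [Fintype F] [Algebra (ZMod 2) F]
  {C : Finset (Submodule (ZMod 2) (Model F))} {W : Submodule (ZMod 2) (Model F)}

/-- A family of subspaces on which the torus acts freely has size divisible by `49`. -/
lemma dvd_card_of_free (hF : Fintype.card F = 8) (D : Finset (Submodule (ZMod 2) (Model F)))
    (hD : ∀ g : Fˣ × Fˣ, ∀ W ∈ D, W.map (torus g).toLinearMap ∈ D)
    (hfree : ∀ W ∈ D, ∀ g : Fˣ × Fˣ, W.map (torus g).toLinearMap = W → g = 1) :
    49 ∣ D.card := by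
  let action : MulAction (Fˣ × Fˣ) D :=
    { smul := fun g W => ⟨W.1.map (torus g).toLinearMap, hD g W.1 W.2⟩
      one_smul := fun W => Subtype.ext (by
        change W.1.map (torus 1).toLinearMap = W.1
        rw [map_one]
        exact Submodule.map_id _)
      mul_smul := fun g h W => Subtype.ext (by
        change W.1.map (torus (g * h)).toLinearMap =
          (W.1.map (torus h).toLinearMap).map (torus g).toLinearMap
        rw [map_mul, ← Submodule.map_comp]
        rfl) }
  have hstab : ∀ W : D, MulAction.stabilizer (Fˣ × Fˣ) W = ⊥ := by
    intro W
    rw [eq_bot_iff]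
    intro g hg
    exact hfree W.1 W.2 g (congrArg Subtype.val (MulAction.mem_stabilizer_iff.1 hg))
  have h := Nat.card_congr (MulAction.selfEquivOrbitsQuotientProd hstab)
  rw [Nat.card_prod, Nat.card_prod, card_units hF, Nat.card_eq_fintype_card,
    Fintype.card_coe] at h
  exact ⟨_, by rw [h]; ring⟩

/-- Every pair of points is contained in at most one codeword. -/
lemma IsTorusCode.sum_card_le (hC : IsTorusCode C)
    {D : Finset (Submodule (ZMod 2) (Model F))} (hD : D ⊆ C)
    (P : Submodule (ZMod 2) (Model F) → Finset (Model F × Model F))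
    (Q : Finset (Model F × Model F)) (hPQ : ∀ W ∈ D, P W ⊆ Q)
    (hP : ∀ W ∈ D, ∀ p ∈ P W, p.1 ∈ W ∧ p.2 ∈ W ∧ p.1 ≠ 0 ∧ p.2 ≠ 0 ∧ p.1 ≠ p.2) :
    ∑ W ∈ D, (P W).card ≤ Q.card := by
  classical
  rw [← card_biUnion]
  · exact card_le_card (biUnion_subset.2 hPQ)
  · intro W₁ h₁ W₂ h₂ hne
    refine Finset.disjoint_left.2 fun p hp₁ hp₂ => hne ?_
    obtain ⟨hx, hy, hx0, hy0, hxy⟩ := hP W₁ h₁ p hp₁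
    obtain ⟨hx', hy', -⟩ := hP W₂ h₂ p hp₂
    exact hC.eq_of_mem (hD h₁) (hD h₂) hx hx' hy hy' hx0 hy0 hxy

open Classical in
/-- The codewords outside the hyperplane `F × F × 0`. -/
noncomputable def outer (C : Finset (Submodule (ZMod 2) (Model F))) :
    Finset (Submodule (ZMod 2) (Model F)) :=
  C.filter fun W => ∃ z ∈ W, z.2.2 = 1

open Classical in
/-- The codewords outside the hyperplane `F × F × 0` that meet the first copy of `F`. -/
noncomputable def outerFst (C : Finset (Submodule (ZMod 2) (Model F))) :
    Finset (Submodule (ZMod 2) (Model F)) :=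
  (outer C).filter fun W => ∃ a : F, a ≠ 0 ∧ (a, 0, 0) ∈ W

open Classical in
/-- The codewords outside the hyperplane `F × F × 0` that meet the second copy of `F`. -/
noncomputable def outerSnd (C : Finset (Submodule (ZMod 2) (Model F))) :
    Finset (Submodule (ZMod 2) (Model F)) :=
  (outer C).filter fun W => ∃ b : F, b ≠ 0 ∧ (0, b, 0) ∈ W

open Classical in
/-- The proper codewords in the hyperplane `F × F × 0`. -/
noncomputable def hyperWords (C : Finset (Submodule (ZMod 2) (Model F))) :
    Finset (Submodule (ZMod 2) (Model F)) :=
  C.filter fun W => (∀ z ∈ W, z.2.2 = 0) ∧ W ≠ fstSpace F ∧ W ≠ sndSpace F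

lemma mem_outer : W ∈ outer C ↔ W ∈ C ∧ ∃ z ∈ W, z.2.2 = 1 := by
  classical
  simp [outer]

lemma mem_outerFst : W ∈ outerFst C ↔ W ∈ outer C ∧ ∃ a : F, a ≠ 0 ∧ (a, 0, 0) ∈ W := by
  classical
  simp [outerFst]

lemma mem_outerSnd : W ∈ outerSnd C ↔ W ∈ outer C ∧ ∃ b : F, b ≠ 0 ∧ (0, b, 0) ∈ W := by
  classical
  simp [outerSnd]

lemma mem_hyperWords : W ∈ hyperWords C ↔
    W ∈ C ∧ (∀ z ∈ W, z.2.2 = 0) ∧ W ≠ fstSpace F ∧ W ≠ sndSpace F := by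
  classical
  simp [hyperWords]

lemma outer_subset : outer C ⊆ C := fun _ hW => (mem_outer.1 hW).1

lemma isProper_of_mem_outer (hW : W ∈ outer C) : IsProper C W := by
  obtain ⟨hW, z, hz, hz1⟩ := mem_outer.1 hW
  refine ⟨hW, ?_, ?_⟩
  · rintro rfl
    exact zero_ne_one ((mem_fstSpace.1 hz).2.symm.trans hz1)
  · rintro rfl
    exact zero_ne_one ((mem_sndSpace.1 hz).2.symm.trans hz1)

lemma isProper_of_mem_hyperWords (hW : W ∈ hyperWords C) : IsProper C W :=
  have h := mem_hyperWords.1 hW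
  ⟨h.1, h.2.2.1, h.2.2.2⟩

lemma card_le_outer_add_hyperWords :
    C.card ≤ (outer C).card + (hyperWords C).card + 2 := by
  classical
  have hsub : C ⊆ outer C ∪ hyperWords C ∪ {fstSpace F, sndSpace F} := by
    intro W hW
    by_cases h : ∃ z ∈ W, z.2.2 = 1
    · simp [mem_outer.2 ⟨hW, h⟩]
    · have h' : ∀ z ∈ W, z.2.2 = 0 := fun z hz =>
        (zmod_two_cases z.2.2).resolve_right fun h1 => h ⟨z, hz, h1⟩
      have := mem_hyperWords (C := C) (W := W)
      simp only [mem_union, mem_insert, mem_singleton]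
      tauto
  exact (card_le_card hsub).trans ((card_union_le _ _).trans
    (add_le_add (card_union_le _ _) card_le_two))

lemma IsTorusCode.map_mem_outer (hC : IsTorusCode C) (g : Fˣ × Fˣ) (hW : W ∈ outer C) :
    W.map (torus g).toLinearMap ∈ outer C := by
  obtain ⟨hW, z, hz, hz1⟩ := mem_outer.1 hW
  exact mem_outer.2 ⟨hC.map_mem g W hW, torus g z, Submodule.mem_map_of_mem hz, by simpa using hz1⟩

lemma IsTorusCode.eq_one_of_map_eq (hC : IsTorusCode C) (hF : Fintype.card F = 8)
    (hW : W ∈ outer C) {g : Fˣ × Fˣ} (hg : W.map (torus g).toLinearMap = W) : g = 1 := by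
  obtain ⟨-, z, hz, hz1⟩ := mem_outer.1 hW
  refine (isProper_of_mem_outer hW).eq_one_of_stable hC hF hz hz1 fun x hx => ?_
  rw [← hg]
  exact Submodule.mem_map_of_mem hx

lemma IsTorusCode.dvd_card_outer (hC : IsTorusCode C) (hF : Fintype.card F = 8) :
    49 ∣ (outer C).card :=
  dvd_card_of_free hF _ (fun g _ hW => hC.map_mem_outer g hW)
    fun _ hW _ hg => hC.eq_one_of_map_eq hF hW hg

lemma IsTorusCode.dvd_card_outerFst (hC : IsTorusCode C) (hF : Fintype.card F = 8) :
    49 ∣ (outerFst C).card := by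
  refine dvd_card_of_free hF _ (fun g W hW => ?_) fun W hW g hg =>
    hC.eq_one_of_map_eq hF (mem_outerFst.1 hW).1 hg
  obtain ⟨hW, a, ha0, ha⟩ := mem_outerFst.1 hW
  refine mem_outerFst.2 ⟨hC.map_mem_outer g hW, g.1 * a, by simpa using ha0, ?_⟩
  simpa using Submodule.mem_map_of_mem (f := (torus g).toLinearMap) ha

open Classical in
/-- The pairs of vectors of `W` outside the hyperplane whose difference lies in the first copy
of `F`. -/
noncomputable def pairsFst (W : Submodule (ZMod 2) (Model F)) : Finset (Model F × Model F) :=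
  (affinePart W).offDiag.filter fun p => p.1.2.1 = p.2.2.1

open Classical in
/-- The pairs of vectors of `W` outside the hyperplane whose difference lies in the second copy
of `F`. -/
noncomputable def pairsSnd (W : Submodule (ZMod 2) (Model F)) : Finset (Model F × Model F) :=
  (affinePart W).offDiag.filter fun p => p.1.1 = p.2.1

open Classical in
/-- The pairs of vectors of `W` outside the hyperplane whose difference lies in no copy
of `F`. -/
noncomputable def pairsMixed (W : Submodule (ZMod 2) (Model F)) : Finset (Model F × Model F) :=
  (affinePart W).offDiag.filter fun p => p.1.1 ≠ p.2.1 ∧ p.1.2.1 ≠ p.2.2.1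

open Classical in
/-- The pairs of vectors of `W` in the hyperplane that span a line disjoint from both copies
of `F`. -/
noncomputable def pairsHyper (W : Submodule (ZMod 2) (Model F)) : Finset (Model F × Model F) :=
  (hyperPart W ×ˢ hyperPart W).filter fun p =>
    (p.1.1 ≠ 0 ∧ p.1.2.1 ≠ 0) ∧ (p.2.1 ≠ 0 ∧ p.2.2.1 ≠ 0) ∧ p.1.1 ≠ p.2.1 ∧ p.1.2.1 ≠ p.2.2.1

lemma mem_pairsFst {p : Model F × Model F} : p ∈ pairsFst W ↔
    (p.1 ∈ W ∧ p.1.2.2 = 1) ∧ (p.2 ∈ W ∧ p.2.2.2 = 1) ∧ p.1 ≠ p.2 ∧ p.1.2.1 = p.2.2.1 := by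
  simp [pairsFst, and_assoc]

lemma mem_pairsSnd {p : Model F × Model F} : p ∈ pairsSnd W ↔
    (p.1 ∈ W ∧ p.1.2.2 = 1) ∧ (p.2 ∈ W ∧ p.2.2.2 = 1) ∧ p.1 ≠ p.2 ∧ p.1.1 = p.2.1 := by
  simp [pairsSnd, and_assoc]

lemma mem_pairsMixed {p : Model F × Model F} : p ∈ pairsMixed W ↔
    (p.1 ∈ W ∧ p.1.2.2 = 1) ∧ (p.2 ∈ W ∧ p.2.2.2 = 1) ∧ p.1 ≠ p.2 ∧ p.1.1 ≠ p.2.1 ∧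
      p.1.2.1 ≠ p.2.2.1 := by
  simp [pairsMixed, and_assoc]

lemma mem_pairsHyper {p : Model F × Model F} : p ∈ pairsHyper W ↔
    (p.1 ∈ W ∧ p.1.2.2 = 0) ∧ (p.2 ∈ W ∧ p.2.2.2 = 0) ∧ (p.1.1 ≠ 0 ∧ p.1.2.1 ≠ 0) ∧
      (p.2.1 ≠ 0 ∧ p.2.2.1 ≠ 0) ∧ p.1.1 ≠ p.2.1 ∧ p.1.2.1 ≠ p.2.2.1 := by
  simp [pairsHyper, and_assoc]

lemma IsProper.card_pairsFst (hW : IsProper C W) (hC : IsTorusCode C) (hF : Fintype.card F = 8)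
    {z : Model F} (hz : z ∈ W) (hz1 : z.2.2 = 1) {a : F} (ha0 : a ≠ 0)
    (ha : ((a, 0, 0) : Model F) ∈ W) : (pairsFst W).card = 4 := by
  classical
  have : pairsFst W = (affinePart W).image fun x => (x, x + (a, 0, 0)) := by
    ext ⟨x, y⟩
    simp only [mem_pairsFst, mem_image, mem_affinePart, Prod.mk.injEq]
    constructor
    · rintro ⟨⟨hx, hx1⟩, ⟨hy, hy1⟩, hxy, h⟩
      refine ⟨x, ⟨hx, hx1⟩, rfl, ?_⟩
      rw [← hW.eq_of_snd_eq_zero hC hF (W.sub_mem hy hx) ha (by simp [h]) rfl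
        (sub_ne_zero.2 hxy.symm) (by simp [Prod.ext_iff, ha0])]
      abel
    · rintro ⟨x, ⟨hx, hx1⟩, rfl, rfl⟩
      exact ⟨⟨hx, hx1⟩, ⟨W.add_mem hx ha, by simp [hx1]⟩, by simp [Prod.ext_iff, ha0], by simp⟩
  rw [this, card_image_of_injective _ fun x y h => (Prod.ext_iff.1 h).1,
    (hW.card_hyperPart hC hz hz1).2]

lemma card_pairsFst_eq_zero (h : ∀ a : F, ((a, 0, 0) : Model F) ∈ W → a = 0) :
    (pairsFst W).card = 0 := by
  rw [card_eq_zero, eq_empty_iff_forall_notMem]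
  rintro ⟨x, y⟩ hp
  obtain ⟨⟨hx, hx1⟩, ⟨hy, hy1⟩, hxy, h1⟩ := mem_pairsFst.1 hp
  have hsub : x - y = (x.1 - y.1, 0, 0) := by
    ext <;> simp_all
  have := h (x.1 - y.1) (by rw [← hsub]; exact W.sub_mem hx hy)
  rw [this] at hsub
  exact hxy (sub_eq_zero.1 hsub)

lemma card_pairsSnd_le (W : Submodule (ZMod 2) (Model F)) :
    (pairsSnd W).card ≤ (pairsFst (W.map (swapEquiv (F := F)).toLinearMap)).card := by
  refine card_le_card_of_injOn (Prod.map swapEquiv swapEquiv) (fun p hp => ?_)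
    (Function.Injective.injOn
      ((swapEquiv (F := F)).injective.prodMap (swapEquiv (F := F)).injective))
  rw [mem_coe, mem_pairsSnd] at hp
  rw [mem_coe, mem_pairsFst]
  exact ⟨⟨Submodule.mem_map_of_mem hp.1.1, hp.1.2⟩,
    ⟨Submodule.mem_map_of_mem hp.2.1.1, hp.2.1.2⟩,
    (swapEquiv (F := F)).injective.ne hp.2.2.1, hp.2.2.2⟩

lemma card_outerSnd_le : (outerSnd C).card ≤ (outerFst (swapCode C)).card := by
  refine card_le_card_of_injOn (fun W => W.map (swapEquiv (F := F)).toLinearMap) (fun W hW => ?_)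
    map_swapEquiv_injective.injOn
  obtain ⟨hW, b, hb0, hb⟩ := mem_outerSnd.1 hW
  obtain ⟨hW, z, hz, hz1⟩ := mem_outer.1 hW
  exact mem_outerFst.2 ⟨mem_outer.2 ⟨map_mem_swapCode hW, swapEquiv z,
    Submodule.mem_map_of_mem hz, hz1⟩, b, hb0, mem_map_swapEquiv.2 hb⟩

lemma IsTorusCode.card_outerFst_le (hC : IsTorusCode C) (hF : Fintype.card F = 8) :
    (outerFst C).card ≤ 49 := by
  classical
  have hsum := hC.sum_card_le (D := outerFst C)
    (fun W hW => outer_subset (mem_outerFst.1 hW).1) pairsFst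
    ((((univ : Finset F).erase 0).offDiag ×ˢ (univ : Finset F)).image
      fun q => ((q.1.1, q.2, 1), (q.1.2, q.2, 1))) ?_ ?_
  · have h4 : ∀ W ∈ outerFst C, (pairsFst W).card = 4 := by
      intro W hW
      obtain ⟨hW, a, ha0, ha⟩ := mem_outerFst.1 hW
      obtain ⟨-, z, hz, hz1⟩ := mem_outer.1 hW
      exact (isProper_of_mem_outer hW).card_pairsFst hC hF hz hz1 ha0 ha
    rw [sum_congr rfl h4, sum_const, smul_eq_mul] at hsum
    have := hsum.trans card_image_le
    rw [card_product, offDiag_card, card_erase_zero hF, card_univ, hF] at this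
    have := hC.dvd_card_outerFst hF
    omega
  · rintro W hW ⟨x, y⟩ hp
    have hprop := isProper_of_mem_outer (mem_outerFst.1 hW).1
    obtain ⟨⟨hx, hx1⟩, ⟨hy, hy1⟩, hxy, h1⟩ := mem_pairsFst.1 hp
    dsimp only at hx hx1 hy hy1 hxy h1
    have hsub : x - y = (x.1 - y.1, 0, 0) := by
      ext <;> simp_all
    have hne : x.1 ≠ y.1 := fun h => hxy (by ext <;> simp_all)
    have hfst : ∀ w ∈ W, w.2.2 = 1 → w.1 ≠ 0 := fun w hw hw1 h0 =>
      sub_ne_zero.2 hne (hprop.notMem_fst hC hF hw h0 (ne_zero_of_affine hw1)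
        (hsub ▸ W.sub_mem hx hy))
    rw [mem_image]
    refine ⟨((x.1, y.1), x.2.1), ?_, ?_⟩
    · simp [hfst x hx hx1, hfst y hy hy1, hne]
    · ext <;> simp_all
  · intro W hW p hp
    obtain ⟨⟨hx, hx1⟩, ⟨hy, hy1⟩, hxy, h1⟩ := mem_pairsFst.1 hp
    exact ⟨hx, hy, ne_zero_of_affine hx1, ne_zero_of_affine hy1, hxy⟩

lemma IsTorusCode.card_outerSnd_le (hC : IsTorusCode C) (hF : Fintype.card F = 8) :
    (outerSnd C).card ≤ 49 :=
  _root_.card_outerSnd_le.trans (hC.swap.card_outerFst_le hF)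

open Classical in
lemma IsTorusCode.card_pairsFst_le (hC : IsTorusCode C) (hF : Fintype.card F = 8)
    (hW : W ∈ outer C) : (pairsFst W).card ≤ if W ∈ outerFst C then 4 else 0 := by
  split_ifs with h
  · obtain ⟨-, a, ha0, ha⟩ := mem_outerFst.1 h
    obtain ⟨-, z, hz, hz1⟩ := mem_outer.1 hW
    exact ((isProper_of_mem_outer hW).card_pairsFst hC hF hz hz1 ha0 ha).le
  · refine (card_pairsFst_eq_zero fun a ha => ?_).le
    by_contra ha0
    exact h (mem_outerFst.2 ⟨hW, a, ha0, ha⟩)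

open Classical in
lemma IsTorusCode.card_pairsSnd_le (hC : IsTorusCode C) (hF : Fintype.card F = 8)
    (hW : W ∈ outer C) : (pairsSnd W).card ≤ if W ∈ outerSnd C then 4 else 0 := by
  refine (_root_.card_pairsSnd_le W).trans ?_
  split_ifs with h
  · obtain ⟨-, b, hb0, hb⟩ := mem_outerSnd.1 h
    obtain ⟨-, z, hz, hz1⟩ := mem_outer.1 hW
    exact ((isProper_of_mem_outer hW).swap.card_pairsFst hC.swap hF
      (Submodule.mem_map_of_mem hz) hz1 hb0 (mem_map_swapEquiv.2 hb)).le
  · refine (card_pairsFst_eq_zero fun b hb => ?_).le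
    by_contra hb0
    exact h (mem_outerSnd.2 ⟨hW, b, hb0, mem_map_swapEquiv.1 hb⟩)

lemma card_offDiag_affinePart_le (W : Submodule (ZMod 2) (Model F)) :
    (affinePart W).offDiag.card ≤
      (pairsMixed W).card + (pairsFst W).card + (pairsSnd W).card := by
  classical
  have hsub : (affinePart W).offDiag ⊆ pairsMixed W ∪ pairsFst W ∪ pairsSnd W := by
    intro p hp
    simp only [mem_offDiag, mem_affinePart] at hp
    simp only [mem_union, mem_pairsMixed, mem_pairsFst, mem_pairsSnd]
    tauto
  exact (card_le_card hsub).trans ((card_union_le _ _).trans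
    (Nat.add_le_add_right (card_union_le _ _) _))

lemma IsTorusCode.sum_pairsMixed_le (hC : IsTorusCode C) (hF : Fintype.card F = 8) :
    ∑ W ∈ outer C, (pairsMixed W).card ≤ 3135 := by
  classical
  have hsum := hC.sum_card_le (D := outer C) outer_subset pairsMixed
    ((((univ : Finset F).offDiag ×ˢ (univ : Finset F).offDiag).erase ((0, 1), (0, 1))).image
      fun q => ((q.1.1, q.2.1, 1), (q.1.2, q.2.2, 1))) ?_ ?_
  · refine (hsum.trans card_image_le).trans ?_
    rw [card_erase_of_mem (by simp), card_product, offDiag_card, card_univ, hF]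
  · rintro W hW ⟨x, y⟩ hp
    obtain ⟨⟨hx, hx1⟩, ⟨hy, hy1⟩, hxy, h1, h2⟩ := mem_pairsMixed.1 hp
    rw [mem_image]
    refine ⟨((x.1, y.1), (x.2.1, y.2.1)), ?_, ?_⟩
    · rw [mem_erase]
      refine ⟨fun h => (isProper_of_mem_outer hW).invariant_point_notMem hC hF ?_, ?_⟩
      · convert hx using 1
        ext <;> simp_all
      · simpa using ⟨h1, h2⟩
    · ext <;> simp_all
  · intro W hW p hp
    obtain ⟨⟨hx, hx1⟩, ⟨hy, hy1⟩, hxy, h1⟩ := mem_pairsMixed.1 hp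
    exact ⟨hx, hy, ne_zero_of_affine hx1, ne_zero_of_affine hy1, hxy⟩

lemma IsTorusCode.card_outer_le (hC : IsTorusCode C) (hF : Fintype.card F = 8) :
    (outer C).card ≤ 245 := by
  classical
  have h12 : ∀ W ∈ outer C, 12 ≤ (pairsMixed W).card +
      (if W ∈ outerFst C then 4 else 0) + if W ∈ outerSnd C then 4 else 0 := by
    intro W hW
    have h := card_offDiag_affinePart_le W
    obtain ⟨-, z, hz, hz1⟩ := mem_outer.1 hW
    rw [offDiag_card, ((isProper_of_mem_outer hW).card_hyperPart hC hz hz1).2] at h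
    have := hC.card_pairsFst_le hF hW
    have := hC.card_pairsSnd_le hF hW
    omega
  have h := sum_le_sum h12
  rw [sum_add_distrib, sum_add_distrib, ← sum_filter, ← sum_filter, sum_const, sum_const,
    sum_const, smul_eq_mul, smul_eq_mul, smul_eq_mul] at h
  have hfst : ((outer C).filter (· ∈ outerFst C)).card ≤ 49 :=
    (card_le_card fun W hW => (mem_filter.1 hW).2).trans (hC.card_outerFst_le hF)
  have hsnd : ((outer C).filter (· ∈ outerSnd C)).card ≤ 49 :=
    (card_le_card fun W hW => (mem_filter.1 hW).2).trans (hC.card_outerSnd_le hF)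
  have := hC.sum_pairsMixed_le hF
  have := hC.dvd_card_outer hF
  omega

/-- If at most `s` vectors of `W` in the hyperplane lie in a copy of `F`, then many pairs span a
line that is disjoint from both copies. -/
lemma le_card_pairsHyper (W : Submodule (ZMod 2) (Model F)) (S : Finset (Model F)) {n s : ℕ}
    (hn : n ≤ (hyperPart W).card) (hs : S.card ≤ s)
    (hS : ∀ x ∈ W, x.2.2 = 0 → (x.1 = 0 ∨ x.2.1 = 0) → x ∈ S) :
    (n - s) * (n - 2 * s) ≤ (pairsHyper W).card := by
  classical
  have hsub : (hyperPart W \ S).sigma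
      (fun x => hyperPart W \ (S ∪ S.image (x + ·))) ⊆
      (pairsHyper W).map (Equiv.sigmaEquivProd (Model F) (Model F)).symm.toEmbedding := by
    rintro ⟨x, y⟩ hp
    simp only [mem_sigma, mem_sdiff, mem_hyperPart, mem_union, mem_image, not_or,
      not_exists, not_and] at hp
    obtain ⟨⟨⟨hx, hx0⟩, hxS⟩, ⟨hy, hy0⟩, hyS, hxyS⟩ := hp
    rw [mem_map_equiv, mem_pairsHyper]
    have hxy : ¬((y - x).1 = 0 ∨ (y - x).2.1 = 0) := fun h =>
      hxyS (y - x) (hS (y - x) (W.sub_mem hy hx) (by simp [hx0, hy0]) h) (by abel)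
    simp only [Prod.fst_sub, Prod.snd_sub, sub_eq_zero, not_or] at hxy
    exact ⟨⟨hx, hx0⟩, ⟨hy, hy0⟩, not_or.1 fun h => hxS (hS x hx hx0 h),
      not_or.1 fun h => hyS (hS y hy hy0 h), Ne.symm hxy.1, Ne.symm hxy.2⟩
  have hcard := card_le_card hsub
  rw [card_map, card_sigma] at hcard
  refine le_trans ?_ hcard
  have hterm : ∀ x ∈ hyperPart W \ S,
      n - 2 * s ≤ (hyperPart W \ (S ∪ S.image (x + ·))).card := by
    intro x _
    have h1 := le_card_sdiff (S ∪ S.image (x + ·)) (hyperPart W)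
    have h2 := card_union_le S (S.image (x + ·))
    have h3 : (S.image (x + ·)).card ≤ S.card := card_image_le
    omega
  have h1 := le_card_sdiff S (hyperPart W)
  calc (n - s) * (n - 2 * s) ≤ (hyperPart W \ S).card * (n - 2 * s) :=
        Nat.mul_le_mul_right _ (by omega)
    _ ≤ _ := by
        rw [← smul_eq_mul]
        exact card_nsmul_le_sum _ _ _ hterm

lemma IsTorusCode.le_card_pairsHyper_of_hyperWords (hC : IsTorusCode C) (hF : Fintype.card F = 8)
    (hW : W ∈ hyperWords C) : 24 ≤ (pairsHyper W).card := by
  classical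
  have hprop := isProper_of_mem_hyperWords hW
  have hcard : 8 ≤ (hyperPart W).card := by
    have h := card_hyperPart_add W (hC.finrank_eq W hprop.mem)
    have : affinePart W = ∅ := by
      rw [eq_empty_iff_forall_notMem]
      intro x hx
      rw [mem_affinePart] at hx
      exact zero_ne_one (((mem_hyperWords.1 hW).2.1 x hx.1).symm.trans hx.2)
    rw [this, card_empty] at h
    omega
  by_cases h : ∃ p ∈ W, p.2.2 = 0 ∧ (p.1 = 0 ∨ p.2.1 = 0) ∧ p ≠ 0
  · obtain ⟨p, hp, hp2, hpor, hp0⟩ := h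
    refine le_card_pairsHyper W {0, p} hcard (card_le_two) fun x hx hx2 hxor => ?_
    by_cases hx0 : x = 0
    · simp [hx0]
    · have : x = p := by
        rcases hpor with hp1 | hp1 <;> rcases hxor with hx1 | hx1
        · exact hprop.eq_of_fst_eq_zero hC hF hx hp hx1 hp1 hx0 hp0
        · have h0 := hprop.notMem_snd hC hF hx hx1 hx0 (b := p.2.1) (by
            convert hp using 1
            ext <;> simp [hp1, hp2])
          exact absurd (by ext <;> simp [hp1, hp2, h0]) hp0
        · have h0 := hprop.notMem_snd hC hF hp hp1 hp0 (b := x.2.1) (by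
            convert hx using 1
            ext <;> simp [hx1, hx2])
          exact absurd (by ext <;> simp [hx1, hx2, h0]) hx0
        · exact hprop.eq_of_snd_eq_zero hC hF hx hp hx1 hp1 hx0 hp0
      simp [this]
  · refine le_card_pairsHyper W {0} hcard (s := 2) (by simp) fun x hx hx2 hxor => ?_
    by_contra hx0
    exact h ⟨x, hx, hx2, hxor, by simpa using hx0⟩

lemma IsTorusCode.le_card_pairsHyper_of_outer (hC : IsTorusCode C)
    (hW : W ∈ outer C) (h1 : W ∉ outerFst C) (h2 : W ∉ outerSnd C) :
    6 ≤ (pairsHyper W).card := by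
  obtain ⟨-, z, hz, hz1⟩ := mem_outer.1 hW
  refine le_card_pairsHyper W {0} ((isProper_of_mem_outer hW).card_hyperPart hC hz hz1).1.ge
    (s := 1) (by simp) fun x hx hx2 hxor => ?_
  rw [mem_singleton]
  by_contra hx0
  rcases hxor with hx1 | hx1
  · refine h2 (mem_outerSnd.2 ⟨hW, x.2.1, fun h => hx0 (by ext <;> simp [hx1, hx2, h]), ?_⟩)
    convert hx using 1
    ext <;> simp [hx1, hx2]
  · refine h1 (mem_outerFst.2 ⟨hW, x.1, fun h => hx0 (by ext <;> simp [hx1, hx2, h]), ?_⟩)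
    convert hx using 1
    ext <;> simp [hx1, hx2]

lemma IsTorusCode.sum_pairsHyper_le (hC : IsTorusCode C) (hF : Fintype.card F = 8) :
    ∑ W ∈ C, (pairsHyper W).card ≤ 1764 := by
  classical
  have hsum := hC.sum_card_le (D := C) subset_rfl pairsHyper
    ((((univ : Finset F).erase 0).offDiag ×ˢ ((univ : Finset F).erase 0).offDiag).image
      fun q => ((q.1.1, q.2.1, 0), (q.1.2, q.2.2, 0))) ?_ ?_
  · refine (hsum.trans card_image_le).trans ?_
    rw [card_product, offDiag_card, card_erase_zero hF]
  · rintro W hW ⟨x, y⟩ hp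
    obtain ⟨⟨hx, hx0⟩, ⟨hy, hy0⟩, hx', hy', h1, h2⟩ := mem_pairsHyper.1 hp
    rw [mem_image]
    refine ⟨((x.1, y.1), (x.2.1, y.2.1)), ?_, ?_⟩
    · simp_all
    · ext <;> simp_all
  · intro W hW p hp
    obtain ⟨⟨hx, hx0⟩, ⟨hy, hy0⟩, hx', hy', h1, h2⟩ := mem_pairsHyper.1 hp
    exact ⟨hx, hy, fun h => hx'.1 (by rw [h]; rfl), fun h => hy'.1 (by rw [h]; rfl),
      fun h => h1 (by rw [h])⟩

lemma IsTorusCode.card_outer_add_card_hyperWords_le (hC : IsTorusCode C)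
    (hF : Fintype.card F = 8) : (outer C).card + 4 * (hyperWords C).card ≤ 392 := by
  classical
  set D := outer C \ (outerFst C ∪ outerSnd C) with hD
  have hdisj : Disjoint D (hyperWords C) := by
    refine Finset.disjoint_left.2 fun W hW hW' => ?_
    obtain ⟨-, z, hz, hz1⟩ := mem_outer.1 (mem_sdiff.1 hW).1
    exact zero_ne_one (((mem_hyperWords.1 hW').2.1 z hz).symm.trans hz1)
  have hsub : D ∪ hyperWords C ⊆ C :=
    union_subset (sdiff_subset.trans outer_subset) fun W hW => (mem_hyperWords.1 hW).1
  have hsum := (sum_le_sum_of_subset hsub (f := fun W => (pairsHyper W).card)).trans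
    (hC.sum_pairsHyper_le hF)
  rw [sum_union hdisj] at hsum
  have houter : D.card • 6 ≤ ∑ W ∈ D, (pairsHyper W).card :=
    card_nsmul_le_sum _ _ _ fun W hW => by
      simp only [hD, mem_sdiff, mem_union, not_or] at hW
      exact hC.le_card_pairsHyper_of_outer hW.1 hW.2.1 hW.2.2
  have hinner : (hyperWords C).card • 24 ≤ ∑ W ∈ hyperWords C, (pairsHyper W).card :=
    card_nsmul_le_sum _ _ _ fun W hW => hC.le_card_pairsHyper_of_hyperWords hF hW
  have h1 := le_card_sdiff (outerFst C ∪ outerSnd C) (outer C)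
  have h2 := card_union_le (outerFst C) (outerSnd C)
  have h3 := hC.card_outerFst_le hF
  have h4 := hC.card_outerSnd_le hF
  rw [smul_eq_mul] at houter hinner
  rw [← hD] at h1
  omega

lemma IsTorusCode.card_le (hC : IsTorusCode C) (hF : Fintype.card F = 8) : C.card ≤ 296 := by
  have h1 := card_le_outer_add_hyperWords (C := C)
  have h2 := hC.card_outer_le hF
  have h3 := hC.card_outer_add_card_hyperWords_le hF
  omega

end Counting

section Sylow

lemma factorization_card_GL : (Nat.card (GL (Fin 7) (ZMod 2))).factorization 7 = 2 := by
  rw [Matrix.card_GL_field, ZMod.card, Nat.factorization_def _ (by norm_num)]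
  have h : (∏ i : Fin 7, (2 ^ 7 - 2 ^ (i : ℕ)) : ℕ) = 7 ^ 2 * 3343877406720 := by
    norm_num [Fin.prod_univ_succ]
  have : Fact (Nat.Prime 7) := ⟨by norm_num⟩
  rw [h, padicValNat.mul (by norm_num) (by norm_num), padicValNat.prime_pow,
    padicValNat.eq_zero_of_not_dvd (by norm_num)]

/-- All subgroups of order `49` of `GL(7,F₂)` are conjugate. -/
lemma exists_conj_mem {U U₀ : Subgroup (GL (Fin 7) (ZMod 2))} (hU : Nat.card U = 49)
    (hU₀ : Nat.card U₀ = 49) : ∃ k : GL (Fin 7) (ZMod 2), ∀ h ∈ U₀, k * h * k⁻¹ ∈ U := by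
  have : Fact (Nat.Prime 7) := ⟨by norm_num⟩
  let S := Sylow.ofCard (p := 7) U (by rw [factorization_card_GL, hU]; norm_num)
  let S₀ := Sylow.ofCard (p := 7) U₀ (by rw [factorization_card_GL, hU₀]; norm_num)
  obtain ⟨k, hk⟩ := MulAction.exists_smul_eq (GL (Fin 7) (ZMod 2)) S₀ S
  refine ⟨k, fun h hh => ?_⟩
  have hmem : MulAut.conj k h ∈ (k • S₀ : Sylow 7 (GL (Fin 7) (ZMod 2))) :=
    Subgroup.smul_mem_pointwise_smul h (MulAut.conj k) U₀ hh
  rw [hk] at hmem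
  exact hmem

end Sylow

section Transfer

variable {F : Type} [Field F] [Algebra (ZMod 2) F]

/-- The embedding of the torus into `GL(7,F₂)` given by coordinates on `F × F × F₂`. -/
noncomputable def torusGL (e : Model F ≃ₗ[ZMod 2] V) : Fˣ × Fˣ →* GL (Fin 7) (ZMod 2) :=
  (Matrix.GeneralLinearGroup.toLin.symm.toMonoidHom.comp
    (LinearMap.GeneralLinearGroup.congrLinearEquiv e).toMonoidHom).comp
    ((LinearMap.GeneralLinearGroup.generalLinearEquiv (ZMod 2) (Model F)).symm.toMonoidHom.comp
      torus)

lemma torusGL_mulVec (e : Model F ≃ₗ[ZMod 2] V) (g : Fˣ × Fˣ) (x : Model F) :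
    Matrix.mulVec (torusGL e g : Matrix (Fin 7) (Fin 7) (ZMod 2)) (e x) = e (torus g x) := by
  have h := Matrix.GeneralLinearGroup.toLin_apply (torusGL e g) (e x)
  rw [Matrix.mulVecLin_apply] at h
  rw [← h]
  simp only [torusGL, MonoidHom.comp_apply, MulEquiv.toMonoidHom_eq_coe, MonoidHom.coe_coe,
    MulEquiv.apply_symm_apply]
  simp [LinearMap.GeneralLinearGroup.congrLinearEquiv]
  rfl

lemma torusGL_injective (e : Model F ≃ₗ[ZMod 2] V) : Function.Injective (torusGL e) := by
  intro g h hgh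
  have key : torus g ((1, 1, 0) : Model F) = torus h (1, 1, 0) := by
    apply e.injective
    rw [← torusGL_mulVec, ← torusGL_mulVec, hgh]
  simp only [torus_apply, mul_one, Prod.mk.injEq, and_true] at key
  exact Prod.ext (Units.ext key.1) (Units.ext key.2)

end Transfer

/-- A `(7,4;3)₂` code invariant under a subgroup of `GL(7,F₂)` of order 49
has at most 296 codewords. -/
theorem stmt_15 (U : Subgroup (GL (Fin 7) (ZMod 2))) (hU : Nat.card U = 49)
    (C : Set (Submodule (ZMod 2) V)) (hC : IsCode C) (hInv : Invariant U C) :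
    C.ncard ≤ 296 := by
  classical
  let F := GaloisField 2 3
  have : Fintype F := Fintype.ofFinite F
  have hF : Fintype.card F = 8 := by
    rw [← Nat.card_eq_fintype_card, GaloisField.card 2 3 (by norm_num)]
    norm_num
  let e : Model F ≃ₗ[ZMod 2] V := LinearEquiv.ofFinrankEq _ _ (by
    rw [finrank_model hF, finrank_fin_fun])
  have hrange : Nat.card (torusGL e).range = 49 := by
    rw [← Nat.card_congr (MonoidHom.ofInjective (torusGL_injective e)).toEquiv, Nat.card_prod,
      card_units hF]
  obtain ⟨k, hk⟩ := exists_conj_mem hU hrange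
  let f : Model F ≃ₗ[ZMod 2] V := e.trans (Matrix.GeneralLinearGroup.toLin k).toLinearEquiv
  have hf : ∀ x, f x = Matrix.mulVec (k : Matrix (Fin 7) (Fin 7) (ZMod 2)) (e x) := fun x => rfl
  have hinj : Function.Injective fun W : Submodule (ZMod 2) V => W.map f.symm.toLinearMap :=
    Submodule.map_injective_of_injective f.symm.injective
  have hfin : C.Finite := Set.toFinite C
  have hD : IsTorusCode (hfin.toFinset.image fun W => W.map f.symm.toLinearMap) := by
    refine ⟨?_, ?_, ?_⟩
    · simp only [mem_image, Set.Finite.mem_toFinset]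
      rintro _ ⟨W, hW, rfl⟩
      rw [LinearEquiv.finrank_map_eq]
      exact hC.1 W hW
    · simp only [mem_image, Set.Finite.mem_toFinset]
      rintro _ ⟨W₁, h₁, rfl⟩ _ ⟨W₂, h₂, rfl⟩ hne
      rw [← Submodule.map_inf _ f.symm.injective, LinearEquiv.finrank_map_eq]
      exact hC.2 W₁ h₁ W₂ h₂ fun h => hne (by rw [h])
    · simp only [mem_image, Set.Finite.mem_toFinset]
      rintro g _ ⟨W, hW, rfl⟩
      refine ⟨_, hInv _ (hk _ ⟨g, rfl⟩) W hW, ?_⟩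
      change (W.map (Matrix.mulVecLin _)).map _ = _
      rw [← Submodule.map_comp, ← Submodule.map_comp]
      congr 1
      refine LinearMap.ext fun y => ?_
      obtain ⟨x, rfl⟩ := f.surjective y
      apply f.injective
      simp only [LinearMap.comp_apply, LinearEquiv.coe_coe, LinearEquiv.apply_symm_apply,
        LinearEquiv.symm_apply_apply, Matrix.mulVecLin_apply]
      rw [hf, hf, ← torusGL_mulVec, Matrix.mulVec_mulVec, Matrix.mulVec_mulVec, ← Units.val_mul,
        ← Units.val_mul, inv_mul_cancel_right]
  have hcard := hD.card_le hF
  rwa [card_image_of_injective _ hinj, ← Set.ncard_eq_toFinset_card C hfin] at hcard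
end

section
/- Let M ∈ GL(7,F₂) be an element of order 7 whose fixed-point space {v ∈ F₂⁷ : v·M = v} has dimension 4, and let C be a set of 3-dimensional F₂-linear subspaces of F₂⁷, any two distinct members of which intersect in a subspace of dimension at most 1, such that C is invariant under M. Then |C| ≤ 296. -/
/-- The fixed-point space of `M ∈ GL(7,F₂)`: the eigenspace of `M` for the eigenvalue `1`,
i.e. the kernel of `M - I`. -/
noncomputable def fixedSpace (M : GL (Fin 7) (ZMod 2)) : Submodule (ZMod 2) V :=
  LinearMap.ker
    (Matrix.mulVecLin (M : Matrix (Fin 7) (Fin 7) (ZMod 2)) - LinearMap.id)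

open Module Finset

/-- A point of prime period `7` that is fixed by an iterate `f^[i]` with `7 ∤ i` is a fixed point. -/
lemma apply_eq_of_iterate_eq {α : Type*} {f : α → α} {a : α} {i : ℕ} (h7 : f^[7] a = a)
    (hi : f^[i] a = a) (hn : ¬ 7 ∣ i) : f a = a := by
  have h : Function.IsPeriodicPt f (Nat.gcd 7 i) a := Function.IsPeriodicPt.gcd h7 hi
  rwa [(Nat.Prime.coprime_iff_not_dvd (by norm_num)).2 hn] at h

section Binary

variable {E : Type*} [AddCommGroup E] [Module (ZMod 2) E]

lemma zmod_two_smul_eq (c : ZMod 2) (v : E) : c • v = 0 ∨ c • v = v := by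
  fin_cases c
  · exact Or.inl (zero_smul _ v)
  · exact Or.inr (one_smul _ v)

/-- A subspace of `F₂`-dimension at most one has at most one nonzero vector. -/
lemma eq_of_finrank_le_one [Finite E] {U : Submodule (ZMod 2) E} (hU : finrank (ZMod 2) U ≤ 1)
    {x y : E} (hx : x ∈ U) (hy : y ∈ U) (hx0 : x ≠ 0) (hy0 : y ≠ 0) : x = y := by
  obtain ⟨v, hv⟩ := finrank_le_one_iff.1 hU
  obtain ⟨c, hc⟩ := hv ⟨x, hx⟩
  obtain ⟨d, hd⟩ := hv ⟨y, hy⟩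
  have hc' : c • (v : E) = x := congrArg Subtype.val hc
  have hd' : d • (v : E) = y := congrArg Subtype.val hd
  rcases zmod_two_smul_eq c (v : E) with h | h <;> rcases zmod_two_smul_eq d (v : E) with h' | h'
  all_goals simp_all

lemma exists_mem_ne_ne_of_two_le_finrank {U : Submodule (ZMod 2) E}
    (hU : 2 ≤ finrank (ZMod 2) U) (p : E) : ∃ f ∈ U, f ≠ 0 ∧ f ≠ p := by
  by_contra! h
  have hle : U ≤ Submodule.span (ZMod 2) {p} := fun f hf => by
    by_cases h0 : f = 0
    · simp [h0]
    · rw [h f hf h0]; exact Submodule.mem_span_singleton_self p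
  have := (Submodule.finrank_mono hle).trans (finrank_span_le_card ({p} : Set E))
  simp at this
  omega

lemma exists_mem_notMem_span_pair [Finite E] {U : Submodule (ZMod 2) E}
    (hU : 3 ≤ finrank (ZMod 2) U) (p x : E) :
    ∃ y ∈ U, y ∉ Submodule.span (ZMod 2) {p, x} := by
  classical
  by_contra! h
  have := (Submodule.finrank_mono (show U ≤ _ from h)).trans
    (finrank_span_le_card ({p, x} : Set E))
  have h2 : ({p, x} : Finset E).card ≤ 2 := Finset.card_le_two
  simp at this
  omega

lemma two_le_finrank_inf [Finite E] {U U' A : Submodule (ZMod 2) E} (hU : U ≤ A) (hU' : U' ≤ A)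
    (h : finrank (ZMod 2) U = 3) (h' : finrank (ZMod 2) U' = 3) (hA : finrank (ZMod 2) A ≤ 4) :
    2 ≤ finrank (ZMod 2) ↥(U ⊓ U') := by
  have h1 := Submodule.finrank_sup_add_finrank_inf_eq U U'
  have h2 := Submodule.finrank_mono (sup_le hU hU')
  omega

end Binary

section PairCount

variable {E : Type*} [AddCommGroup E] [Module (ZMod 2) E] [Fintype E]

open Classical in
/-- The ordered pairs of vectors of `W` that are linearly independent modulo `F`. -/
noncomputable def pairsModulo (F W : Submodule (ZMod 2) E) : Finset (Σ _ : E, E) :=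
  ({x | x ∈ W ∧ x ∉ F} : Finset E).sigma
    fun x => {y | y ∈ W ∧ y ∉ F ∧ x - y ∉ F}

lemma mem_pairsModulo {F W : Submodule (ZMod 2) E} {z : Σ _ : E, E} :
    z ∈ pairsModulo F W ↔ (z.1 ∈ W ∧ z.1 ∉ F) ∧ z.2 ∈ W ∧ z.2 ∉ F ∧ z.1 - z.2 ∉ F := by
  simp [pairsModulo]

lemma card_pairsModulo (F W : Submodule (ZMod 2) E) :
    (pairsModulo F W).card =
      (Nat.card W - Nat.card ↥(W ⊓ F)) * (Nat.card W - 2 * Nat.card ↥(W ⊓ F)) := by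
  classical
  have hcard : ∀ U : Submodule (ZMod 2) E, Nat.card U = #{x : E | x ∈ U} := fun U => by
    rw [← Nat.subtype_card]
    simp
  have hA : #{x : E | x ∈ W ∧ x ∉ F} = Nat.card W - Nat.card ↥(W ⊓ F) := by
    rw [hcard, hcard, ← Finset.card_filter_add_card_filter_not (s := {x : E | x ∈ W}) (· ∈ F)]
    simp [Finset.filter_filter]
  rw [pairsModulo, Finset.card_sigma,
    Finset.sum_const_nat (m := Nat.card W - 2 * Nat.card ↥(W ⊓ F)), hA]
  intro x hx
  obtain ⟨hxW, hxF⟩ : x ∈ W ∧ x ∉ F := by simpa using hx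
  have hB : #{y : E | (y ∈ W ∧ y ∉ F) ∧ x - y ∈ F} = #{y : E | y ∈ W ⊓ F} := by
    refine Finset.card_bij' (fun y _ => x - y) (fun y _ => x - y) ?_ ?_ (by simp) (by simp)
    · intro y hy
      simp only [Finset.mem_filter, Finset.mem_univ, true_and] at hy
      simpa [hy.2] using W.sub_mem hxW hy.1.1
    · intro y hy
      simp only [Finset.mem_filter, Finset.mem_univ, true_and, Submodule.mem_inf] at hy
      simp only [Finset.mem_filter, Finset.mem_univ, true_and, sub_sub_cancel]
      exact ⟨⟨W.sub_mem hxW hy.1, fun h => hxF (by simpa using F.add_mem h hy.2)⟩, hy.2⟩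
  have h1 := Finset.card_filter_add_card_filter_not (s := {y : E | y ∈ W ∧ y ∉ F})
    (fun y => x - y ∈ F)
  simp only [Finset.filter_filter] at h1
  rw [hB, ← hcard, hA] at h1
  simp only [and_assoc] at h1
  omega

lemma natCard_eq_two_pow_finrank (U : Submodule (ZMod 2) E) :
    Nat.card U = 2 ^ finrank (ZMod 2) U := by
  rw [Module.natCard_eq_pow_finrank (K := ZMod 2), Nat.card_zmod]

lemma disjoint_pairsModulo {F U U' : Submodule (ZMod 2) E}
    (hUU' : ∀ x ∈ U, x ∈ U' → ∀ y ∈ U, y ∈ U' → x ≠ 0 → y ≠ 0 → x = y) :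
    Disjoint (pairsModulo F U) (pairsModulo F U') := by
  rw [Finset.disjoint_left]
  intro z hz hz'
  rw [mem_pairsModulo] at hz hz'
  have hF : ∀ {v}, v ∉ F → v ≠ 0 := fun {v} hv h0 => hv (h0 ▸ F.zero_mem)
  exact hF hz.2.2.2 (sub_eq_zero.2 (hUU' _ hz.1.1 hz'.1.1 _ hz.2.1 hz'.2.1 (hF hz.1.2)
    (hF hz.2.2.1)))

lemma card_pairsModulo_of_inf_eq_bot {F W : Submodule (ZMod 2) E}
    (hW : finrank (ZMod 2) W = 3) (hbot : W ⊓ F = ⊥) :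
    (pairsModulo F W).card = 42 := by
  rw [card_pairsModulo, hbot, natCard_eq_two_pow_finrank, hW]
  simp

end PairCount

section Action

variable {E : Type*} [AddCommGroup E] [Module (ZMod 2) E] {T : E →ₗ[ZMod 2] E}

lemma iterate_mem_iterate_map {W : Submodule (ZMod 2) E} {x : E} (hx : x ∈ W) (i : ℕ) :
    T^[i] x ∈ (Submodule.map T)^[i] W := by
  induction i with
  | zero => exact hx
  | succ i ih =>
    rw [Function.iterate_succ_apply', Function.iterate_succ_apply']
    exact Submodule.mem_map_of_mem ih

/-- The sum of the first seven powers of `T`; if `T ^ 7 = 1`, it is the projection onto the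
fixed space of `T`. -/
noncomputable def orbitSum (T : E →ₗ[ZMod 2] E) : E →ₗ[ZMod 2] E := ∑ i ∈ range 7, T ^ i

lemma orbitSum_apply (x : E) : orbitSum T x = ∑ i ∈ range 7, T^[i] x := by
  simp [orbitSum, LinearMap.sum_apply, Module.End.pow_apply]

lemma orbitSum_of_apply_eq {x : E} (hx : T x = x) : orbitSum T x = x := by
  rw [orbitSum_apply, Finset.sum_congr rfl fun i _ => Function.iterate_fixed hx i]
  rw [Finset.sum_const, Finset.card_range, ← Nat.cast_smul_eq_nsmul (ZMod 2),
    show ((7 : ℕ) : ZMod 2) = 1 from rfl, one_smul]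

lemma apply_orbitSum (hT : T ^ 7 = 1) (x : E) : T (orbitSum T x) = orbitSum T x := by
  have h : (T - 1) * orbitSum T = 0 := by rw [orbitSum, mul_geom_sum, hT, sub_self]
  simpa [sub_eq_zero] using LinearMap.congr_fun h x

lemma orbitSum_apply_self (hT : T ^ 7 = 1) (x : E) : orbitSum T (T x) = orbitSum T x := by
  have h : orbitSum T * (T - 1) = 0 := by rw [orbitSum, geom_sum_mul, hT, sub_self]
  simpa [sub_eq_zero] using LinearMap.congr_fun h x

lemma iterate_seven (hT : T ^ 7 = 1) (x : E) : T^[7] x = x := by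
  rw [← Module.End.pow_apply, hT]; rfl

lemma iterate_map_seven (hT : T ^ 7 = 1) (W : Submodule (ZMod 2) E) :
    (Submodule.map T)^[7] W = W := by
  refine le_antisymm ?_ fun x hx => iterate_seven hT x ▸ iterate_mem_iterate_map hx 7
  have h : (Submodule.map T)^[7] W = W.map (T ^ 7) := by
    simp only [Function.iterate_succ_apply, Function.iterate_zero_apply, ← Submodule.map_comp]
    rfl
  rw [h, hT]
  exact (Submodule.map_id W).le

lemma finrank_map_of_pow_seven (hT : T ^ 7 = 1) (W : Submodule (ZMod 2) E) :
    finrank (ZMod 2) (W.map T) = finrank (ZMod 2) W := by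
  have hinj : Function.Injective T := fun x y h => by
    rw [← iterate_seven hT x, ← iterate_seven hT y, Function.iterate_succ_apply, h,
      ← Function.iterate_succ_apply]
  exact (Submodule.equivMapOfInjective T hinj W).finrank_eq.symm

end Action

section InvariantCode

variable {E : Type*} [AddCommGroup E] [Module (ZMod 2) E]

/-- `T` satisfies `T ^ 7 = 1` on a `7`-dimensional space, has a `4`-dimensional fixed space, and
leaves invariant the code `C` of `3`-dimensional subspaces meeting pairwise in dimension `≤ 1`. -/
structure IsInvariantCode (T : E →ₗ[ZMod 2] E) (C : Set (Submodule (ZMod 2) E)) : Prop where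
  pow_seven : T ^ 7 = 1
  finrank_space : finrank (ZMod 2) E = 7
  finrank_fixed : finrank (ZMod 2) (LinearMap.ker (T - LinearMap.id)) = 4
  finrank_mem : ∀ W ∈ C, finrank (ZMod 2) W = 3
  finrank_inf : ∀ W₁ ∈ C, ∀ W₂ ∈ C, W₁ ≠ W₂ → finrank (ZMod 2) ↥(W₁ ⊓ W₂) ≤ 1
  map_mem : ∀ W ∈ C, W.map T ∈ C

lemma mem_ker_sub_id {T : E →ₗ[ZMod 2] E} {x : E} :
    x ∈ LinearMap.ker (T - LinearMap.id) ↔ T x = x := by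
  simp [sub_eq_zero]

namespace IsInvariantCode

variable {T : E →ₗ[ZMod 2] E} {C : Set (Submodule (ZMod 2) E)} {W W' : Submodule (ZMod 2) E}

lemma iterate_map_mem (h : IsInvariantCode T C) (hW : W ∈ C) (i : ℕ) :
    (Submodule.map T)^[i] W ∈ C := by
  induction i with
  | zero => exact hW
  | succ i ih => rw [Function.iterate_succ_apply']; exact h.map_mem _ ih

lemma sub_orbitSum_mem_ker (h : IsInvariantCode T C) (x : E) :
    x - orbitSum T x ∈ LinearMap.ker (orbitSum T) := by
  rw [LinearMap.mem_ker, map_sub, orbitSum_of_apply_eq (apply_orbitSum h.pow_seven x), sub_self]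

variable [Fintype E]

lemma eq_of_mem (h : IsInvariantCode T C) (hW : W ∈ C) (hW' : W' ∈ C) {x y : E}
    (hx : x ∈ W) (hx' : x ∈ W') (hy : y ∈ W) (hy' : y ∈ W') (hx0 : x ≠ 0) (hy0 : y ≠ 0)
    (hxy : x ≠ y) : W = W' := by
  by_contra hne
  exact hxy (eq_of_finrank_le_one (h.finrank_inf W hW W' hW' hne) ⟨hx, hx'⟩ ⟨hy, hy'⟩ hx0 hy0)

lemma finrank_ker_orbitSum (h : IsInvariantCode T C) :
    finrank (ZMod 2) (LinearMap.ker (orbitSum T)) = 3 := by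
  have hr : LinearMap.range (orbitSum T) = LinearMap.ker (T - LinearMap.id) := by
    ext x
    rw [mem_ker_sub_id]
    constructor
    · rintro ⟨y, rfl⟩
      exact apply_orbitSum h.pow_seven y
    · exact fun hx => ⟨x, orbitSum_of_apply_eq hx⟩
  have h1 := LinearMap.finrank_range_add_finrank_ker (orbitSum T)
  rw [hr, h.finrank_fixed, h.finrank_space] at h1
  omega

/-- `T` permutes the nonzero vectors of the kernel of `orbitSum T` transitively. -/
lemma exists_iterate_eq (h : IsInvariantCode T C) {x y : E} (hx : orbitSum T x = 0)
    (hy : orbitSum T y = 0) (hx0 : x ≠ 0) (hy0 : y ≠ 0) : ∃ i, T^[i] x = y := by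
  classical
  have hcard : #{z : E | z ∈ LinearMap.ker (orbitSum T)} = 8 := by
    rw [← Fintype.card_subtype, ← Nat.card_eq_fintype_card]
    exact (natCard_eq_two_pow_finrank _).trans (by rw [h.finrank_ker_orbitSum]; norm_num)
  have hne : T x ≠ x := fun hTx => hx0 (by rw [← orbitSum_of_apply_eq hTx, hx])
  have h7 : Function.minimalPeriod T x = 7 := by
    have : Fact (Nat.Prime 7) := ⟨by norm_num⟩
    exact Function.minimalPeriod_eq_prime (iterate_seven h.pow_seven x) hne
  have hinj : Set.InjOn (fun i => T^[i] x) (range 7) := fun i hi j hj hij => by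
    simp only [coe_range, Set.mem_Iio] at hi hj
    exact Function.iterate_injOn_Iio_minimalPeriod (by simpa [h7] using hi)
      (by simpa [h7] using hj) hij
  have hK : ∀ i, orbitSum T (T^[i] x) = 0 := fun i => by
    induction i with
    | zero => exact hx
    | succ i ih => rw [Function.iterate_succ_apply', orbitSum_apply_self h.pow_seven, ih]
  have hsub : (range 7).image (fun i => T^[i] x) ⊆
      ({z : E | z ∈ LinearMap.ker (orbitSum T)} : Finset E).erase 0 := by
    intro z hz
    obtain ⟨i, hi, rfl⟩ := Finset.mem_image.1 hz
    have h0 : T^[i] x ≠ 0 := fun h0 => hx0 <| by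
      rw [← iterate_seven h.pow_seven x, show 7 = (7 - i) + i by simp at hi; omega,
        Function.iterate_add_apply, h0]
      exact Function.iterate_fixed (map_zero T) _
    simpa [h0] using hK i
  have heq := Finset.eq_of_subset_of_card_le hsub <| by
    rw [Finset.card_image_of_injOn hinj, Finset.card_erase_of_mem (by simp), hcard]
    simp
  have hy' : y ∈ (range 7).image (fun i => T^[i] x) := by
    rw [heq]
    simp [hy, hy0]
  obtain ⟨i, -, hi⟩ := Finset.mem_image.1 hy'
  exact ⟨i, hi⟩

/-- Two non-fixed vectors with the same projection to the fixed space are in one `T`-orbit. -/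
lemma exists_iterate_eq_of_orbitSum_eq (h : IsInvariantCode T C) {x y : E} (hx : T x ≠ x)
    (hy : T y ≠ y) (hxy : orbitSum T x = orbitSum T y) : ∃ i, T^[i] x = y := by
  have hne : ∀ {z}, T z ≠ z → z - orbitSum T z ≠ 0 := fun {z} hz h0 => hz <| by
    conv_lhs => rw [sub_eq_zero.1 h0]
    rw [apply_orbitSum h.pow_seven, ← sub_eq_zero.1 h0]
  obtain ⟨i, hi⟩ := h.exists_iterate_eq (h.sub_orbitSum_mem_ker x) (h.sub_orbitSum_mem_ker y)
    (hne hx) (hne hy)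
  refine ⟨i, ?_⟩
  rw [← Module.End.pow_apply, map_sub, Module.End.pow_apply, Module.End.pow_apply,
    Function.iterate_fixed (apply_orbitSum h.pow_seven x), hxy] at hi
  exact sub_left_injective hi

/-- A `T`-invariant codeword lies in the fixed space or is the kernel of `orbitSum T`. -/
lemma le_or_eq_of_map_eq (h : IsInvariantCode T C) (hW : W ∈ C) (hfix : W.map T = W) :
    W ≤ LinearMap.ker (T - LinearMap.id) ∨ W = LinearMap.ker (orbitSum T) := by
  by_contra! hcon
  obtain ⟨w, hw, hwF⟩ := SetLike.not_le_iff_exists.1 hcon.1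
  rw [mem_ker_sub_id] at hwF
  have hiter : ∀ {x}, x ∈ W → ∀ i, T^[i] x ∈ W := fun {x} hx i => by
    have := iterate_mem_iterate_map (T := T) hx i
    rwa [Function.iterate_fixed hfix] at this
  have hN : orbitSum T w ∈ W := by
    rw [orbitSum_apply]
    exact Submodule.sum_mem _ fun i _ => hiter hw i
  have hle : LinearMap.ker (orbitSum T) ≤ W := fun y hy => by
    by_cases hy0 : y = 0
    · simp [hy0]
    · obtain ⟨i, rfl⟩ := h.exists_iterate_eq (h.sub_orbitSum_mem_ker w) hy (fun h0 => hwF <| by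
        conv_lhs => rw [sub_eq_zero.1 h0]
        rw [apply_orbitSum h.pow_seven, ← sub_eq_zero.1 h0]) hy0
      exact hiter (W.sub_mem hw hN) i
  exact hcon.2 (Submodule.eq_of_le_of_finrank_eq hle
    (by rw [h.finrank_ker_orbitSum, h.finrank_mem W hW])).symm

lemma map_ker_orbitSum (h : IsInvariantCode T C) :
    (LinearMap.ker (orbitSum T)).map T = LinearMap.ker (orbitSum T) := by
  refine Submodule.eq_of_le_of_finrank_eq ?_ (finrank_map_of_pow_seven h.pow_seven _)
  rintro _ ⟨x, hx, rfl⟩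
  rw [LinearMap.mem_ker, orbitSum_apply_self h.pow_seven]
  exact hx

lemma eq_of_mem_fixed (h : IsInvariantCode T C) (hW : W ∈ C) (hne : W.map T ≠ W) {x y : E}
    (hx : x ∈ W) (hy : y ∈ W) (hTx : T x = x) (hTy : T y = y) (hx0 : x ≠ 0) (hy0 : y ≠ 0) :
    x = y := by
  by_contra hxy
  exact hne (h.eq_of_mem (h.map_mem W hW) hW ⟨x, hx, hTx⟩ hx ⟨y, hy, hTy⟩ hy hx0 hy0 hxy)

lemma eq_of_mem_ker_orbitSum (h : IsInvariantCode T C) (hW : W ∈ C) (hne : W.map T ≠ W)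
    {x y : E} (hx : x ∈ W) (hy : y ∈ W) (hKx : orbitSum T x = 0) (hKy : orbitSum T y = 0)
    (hx0 : x ≠ 0) (hy0 : y ≠ 0) : x = y := by
  by_contra hxy
  have h2 : 2 ≤ finrank (ZMod 2) ↥(W ⊓ LinearMap.ker (orbitSum T)) := by
    by_contra! hlt
    exact hxy (eq_of_finrank_le_one (Nat.lt_succ_iff.1 hlt) ⟨hx, hKx⟩ ⟨hy, hKy⟩ hx0 hy0)
  have h4 : finrank (ZMod 2) ↥(W ⊔ LinearMap.ker (orbitSum T)) ≤ 4 := by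
    have := Submodule.finrank_sup_add_finrank_inf_eq W (LinearMap.ker (orbitSum T))
    rw [h.finrank_mem W hW, h.finrank_ker_orbitSum] at this
    omega
  have hle : W.map T ≤ W ⊔ LinearMap.ker (orbitSum T) := by
    rintro _ ⟨w, hw, rfl⟩
    refine Submodule.mem_sup.2 ⟨w, hw, T w - w, ?_, add_sub_cancel _ _⟩
    rw [LinearMap.mem_ker, map_sub, orbitSum_apply_self h.pow_seven, sub_self]
  have := two_le_finrank_inf hle le_sup_left (h.finrank_mem _ (h.map_mem W hW))
    (h.finrank_mem W hW) h4
  have := h.finrank_inf _ (h.map_mem W hW) W hW hne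
  omega

/-- A non-invariant codeword containing a nonzero fixed vector projects injectively to the
fixed space. -/
lemma eq_zero_of_mem_ker_orbitSum (h : IsInvariantCode T C) (hW : W ∈ C) (hne : W.map T ≠ W)
    {p x : E} (hp : p ∈ W) (hTp : T p = p) (hp0 : p ≠ 0) (hx : x ∈ W) (hKx : orbitSum T x = 0) :
    x = 0 := by
  by_contra hx0
  obtain ⟨y, hy, hspan⟩ := exists_mem_notMem_span_pair (h.finrank_mem W hW).ge p x
  have hpS : p ∈ Submodule.span (ZMod 2) {p, x} := Submodule.subset_span (by simp)
  have hxS : x ∈ Submodule.span (ZMod 2) {p, x} := Submodule.subset_span (by simp)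
  have hxyS : x + y ∉ Submodule.span (ZMod 2) {p, x} := fun hS =>
    hspan (by simpa using Submodule.sub_mem _ hS hxS)
  have hxy : x + y ∈ W := W.add_mem hx hy
  have hT : ∀ {z}, z ∈ W → z ∉ Submodule.span (ZMod 2) {p, x} → T z ≠ z := fun {z} hz hzS hTz =>
    hzS (h.eq_of_mem_fixed hW hne hp hz hTp hTz hp0
      (fun h0 => hzS (h0 ▸ Submodule.zero_mem _)) ▸ hpS)
  obtain ⟨i, hi⟩ := h.exists_iterate_eq_of_orbitSum_eq (hT hy hspan) (hT hxy hxyS)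
    (by rw [map_add, hKx, zero_add])
  have hWi : (Submodule.map T)^[i] W = W := by
    refine h.eq_of_mem (h.iterate_map_mem hW i) hW (x := p) (y := x + y) ?_ hp ?_ hxy hp0
      (fun h0 => hxyS (h0 ▸ Submodule.zero_mem _)) (fun h0 => hxyS (h0 ▸ hpS))
    · have := iterate_mem_iterate_map (T := T) hp i
      rwa [Function.iterate_fixed hTp] at this
    · exact hi ▸ iterate_mem_iterate_map hy i
  refine hne (apply_eq_of_iterate_eq (iterate_map_seven h.pow_seven W) hWi ?_)
  rintro ⟨k, rfl⟩
  rw [Function.iterate_mul, Function.iterate_fixed (iterate_seven h.pow_seven y)] at hi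
  exact hx0 (by simpa using hi)

/-- The non-invariant codewords through a given nonzero fixed vector form a single orbit. -/
lemma exists_iterate_map_eq (h : IsInvariantCode T C) (hW : W ∈ C) (hne : W.map T ≠ W)
    (hW' : W' ∈ C) (hne' : W'.map T ≠ W') {p : E} (hp : p ∈ W) (hp' : p ∈ W') (hTp : T p = p)
    (hp0 : p ≠ 0) : ∃ i < 7, (Submodule.map T)^[i] W = W' := by
  have hrank : ∀ {U}, U ∈ C → U.map T ≠ U → p ∈ U →
      finrank (ZMod 2) (U.map (orbitSum T)) = 3 := fun {U} hU hneU hpU => by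
    rw [← h.finrank_mem U hU, ← LinearMap.range_domRestrict]
    refine LinearMap.finrank_range_of_inj (LinearMap.ker_eq_bot.1 (LinearMap.ker_eq_bot'.2 ?_))
    exact fun x hx =>
      Subtype.ext (h.eq_zero_of_mem_ker_orbitSum hU hneU hpU hTp hp0 x.2 hx)
  have hle : ∀ U : Submodule (ZMod 2) E,
      U.map (orbitSum T) ≤ LinearMap.ker (T - LinearMap.id) := by
    rintro U _ ⟨x, -, rfl⟩
    exact mem_ker_sub_id.2 (apply_orbitSum h.pow_seven x)
  obtain ⟨f, ⟨⟨w, hw, hwf⟩, ⟨w', hw', hwf'⟩⟩, hf0, hfp⟩ := exists_mem_ne_ne_of_two_le_finrank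
    (two_le_finrank_inf (hle W) (hle W') (hrank hW hne hp) (hrank hW' hne' hp')
      h.finrank_fixed.le) p
  have hT : ∀ {U z}, U ∈ C → U.map T ≠ U → p ∈ U → z ∈ U → orbitSum T z = f → T z ≠ z :=
    fun {U z} hU hneU hpU hz hzf hTz => by
      rw [orbitSum_of_apply_eq hTz] at hzf
      subst hzf
      exact hfp (h.eq_of_mem_fixed hU hneU hz hpU hTz hTp hf0 hp0)
  obtain ⟨i, hi⟩ := h.exists_iterate_eq_of_orbitSum_eq (hT hW hne hp hw hwf)
    (hT hW' hne' hp' hw' hwf') (hwf.trans hwf'.symm)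
  refine ⟨i % 7, Nat.mod_lt _ (by norm_num), ?_⟩
  rw [Function.IsPeriodicPt.iterate_mod_apply (iterate_map_seven h.pow_seven W)]
  refine h.eq_of_mem (h.iterate_map_mem hW i) hW' (x := p) (y := w') ?_ hp' ?_ hw' hp0 ?_ ?_
  · have := iterate_mem_iterate_map (T := T) hp i
    rwa [Function.iterate_fixed hTp] at this
  · exact hi ▸ iterate_mem_iterate_map hw i
  · rintro rfl
    exact hf0 (by rw [← hwf', map_zero])
  · rintro rfl
    exact hfp (by rw [← hwf', orbitSum_of_apply_eq hTp])

open Classical in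
lemma card_filter_fixed_mem_le (h : IsInvariantCode T C) :
    #{W : Submodule (ZMod 2) E | (W ∈ C ∧ W.map T ≠ W) ∧ ∃ p ∈ W, T p = p ∧ p ≠ 0} ≤ 105 := by
  have hF : #{p : E | T p = p ∧ p ≠ 0} = 15 := by
    have hcard : #{p : E | T p = p} = 16 := by
      rw [← Fintype.card_subtype, ← Nat.card_eq_fintype_card]
      have := natCard_eq_two_pow_finrank (LinearMap.ker (T - LinearMap.id))
      rw [h.finrank_fixed] at this
      simpa [sub_eq_zero] using this
    rw [← Finset.filter_filter, Finset.filter_ne', Finset.card_erase_of_mem (by simp), hcard]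
  calc _ ≤ #(({p : E | T p = p ∧ p ≠ 0} : Finset E).biUnion fun p =>
        {W : Submodule (ZMod 2) E | (W ∈ C ∧ W.map T ≠ W) ∧ p ∈ W}) := by
        refine Finset.card_le_card fun W hW => ?_
        simp only [Finset.mem_filter, Finset.mem_univ, true_and, Finset.mem_biUnion] at hW ⊢
        obtain ⟨hW, p, hp, hTp⟩ := hW
        exact ⟨p, hTp, hW, hp⟩
    _ ≤ #{p : E | T p = p ∧ p ≠ 0} * 7 := Finset.card_biUnion_le_card_mul _ _ _ fun p hp => by
        simp only [Finset.mem_filter, Finset.mem_univ, true_and] at hp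
        rcases Finset.eq_empty_or_nonempty
          {W : Submodule (ZMod 2) E | (W ∈ C ∧ W.map T ≠ W) ∧ p ∈ W} with h0 | ⟨W, hW⟩
        · simp [h0]
        · simp only [Finset.mem_filter, Finset.mem_univ, true_and] at hW
          calc _ ≤ #((range 7).image fun i => (Submodule.map T)^[i] W) := by
                refine Finset.card_le_card fun W' hW' => ?_
                simp only [Finset.mem_filter, Finset.mem_univ, true_and] at hW'
                obtain ⟨i, hi, hiW⟩ := h.exists_iterate_map_eq hW.1.1 hW.1.2 hW'.1.1 hW'.1.2
                  hW.2 hW'.2 hp.1 hp.2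
                exact Finset.mem_image.2 ⟨i, Finset.mem_range.2 hi, hiW⟩
            _ ≤ 7 := Finset.card_image_le.trans (by simp)
    _ = 105 := by rw [hF]

open Classical in
lemma card_filter_map_ne_le (h : IsInvariantCode T C) :
    #{W : Submodule (ZMod 2) E | W ∈ C ∧ W.map T ≠ W} ≤ 300 := by
  set F := LinearMap.ker (T - LinearMap.id)
  set K := LinearMap.ker (orbitSum T)
  set D : Finset (Submodule (ZMod 2) E) := {W | W ∈ C ∧ W.map T ≠ W} with hD
  have hmem : ∀ {U}, U ∈ D ↔ U ∈ C ∧ U.map T ≠ U := by simp [hD]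
  have hKD : K ∉ D := fun hK => (hmem.1 hK).2 h.map_ker_orbitSum
  have hdisj : ((insert K D : Finset _) : Set (Submodule (ZMod 2) E)).PairwiseDisjoint
      (pairsModulo F) := by
    rw [Finset.coe_insert]
    refine (Set.pairwiseDisjoint_insert_of_notMem (by simpa using hKD)).2 ⟨?_, ?_⟩
    · intro U hU U' hU' hne
      refine disjoint_pairsModulo fun x hx hx' y hy hy' hx0 hy0 => ?_
      by_contra hxy
      exact hne (h.eq_of_mem (hmem.1 hU).1 (hmem.1 hU').1 hx hx' hy hy' hx0 hy0 hxy)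
    · intro U hU
      exact disjoint_pairsModulo fun x hx hx' y hy hy' hx0 hy0 =>
        h.eq_of_mem_ker_orbitSum (hmem.1 hU).1 (hmem.1 hU).2 hx' hy' hx hy hx0 hy0
  have hK42 : (pairsModulo F K).card = 42 := by
    refine card_pairsModulo_of_inf_eq_bot h.finrank_ker_orbitSum ?_
    rw [eq_bot_iff]
    rintro x ⟨hxK, hxF⟩
    rw [Submodule.mem_bot, ← orbitSum_of_apply_eq (mem_ker_sub_id.1 hxF)]
    exact hxK
  have htop : (pairsModulo F ⊤).card = 10752 := by
    rw [card_pairsModulo, top_inf_eq, natCard_eq_two_pow_finrank, natCard_eq_two_pow_finrank,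
      finrank_top, h.finrank_space, h.finrank_fixed]
    norm_num
  have hsum : ∑ U ∈ insert K D, (pairsModulo F U).card ≤ 10752 := by
    rw [← htop, ← Finset.card_biUnion hdisj]
    refine Finset.card_le_card fun z hz => ?_
    obtain ⟨U, -, hz⟩ := Finset.mem_biUnion.1 hz
    rw [mem_pairsModulo] at hz ⊢
    simpa using ⟨hz.1.2, hz.2.2⟩
  have hthrough : ∀ U ∈ D, (∃ p ∈ U, T p = p ∧ p ≠ 0) → (pairsModulo F U).card = 24 := by
    rintro U hU ⟨p, hp, hTp, hp0⟩
    have hspan : U ⊓ F = Submodule.span (ZMod 2) {p} := by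
      refine le_antisymm ?_ ?_
      · rintro x ⟨hx, hxF⟩
        by_cases hx0 : x = 0
        · simp [hx0]
        · rw [h.eq_of_mem_fixed (hmem.1 hU).1 (hmem.1 hU).2 hx hp (mem_ker_sub_id.1 hxF) hTp
            hx0 hp0]
          exact Submodule.mem_span_singleton_self p
      · rw [Submodule.span_singleton_le_iff_mem]
        exact ⟨hp, mem_ker_sub_id.2 hTp⟩
    rw [card_pairsModulo, hspan, natCard_eq_two_pow_finrank, natCard_eq_two_pow_finrank,
      finrank_span_singleton hp0, h.finrank_mem U (hmem.1 hU).1]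
    norm_num
  have havoid : ∀ U ∈ D, (¬ ∃ p ∈ U, T p = p ∧ p ≠ 0) → (pairsModulo F U).card = 42 := by
    intro U hU hno
    refine card_pairsModulo_of_inf_eq_bot (h.finrank_mem U (hmem.1 hU).1) ?_
    rw [eq_bot_iff]
    rintro x ⟨hxU, hxF⟩
    by_contra hx0
    exact hno ⟨x, hxU, mem_ker_sub_id.1 hxF, hx0⟩
  have h105 := h.card_filter_fixed_mem_le
  rw [← Finset.filter_filter, ← hD] at h105
  have hsplit := Finset.card_filter_add_card_filter_not (s := D)
    (fun U => ∃ p ∈ U, T p = p ∧ p ≠ 0)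
  rw [Finset.sum_insert hKD, hK42,
    ← Finset.sum_filter_add_sum_filter_not D (fun U => ∃ p ∈ U, T p = p ∧ p ≠ 0),
    Finset.sum_const_nat fun U hU => hthrough U (Finset.mem_filter.1 hU).1
      (Finset.mem_filter.1 hU).2,
    Finset.sum_const_nat fun U hU => havoid U (Finset.mem_filter.1 hU).1
      (Finset.mem_filter.1 hU).2] at hsum
  omega

open Classical in
lemma seven_dvd_card_filter_map_ne (h : IsInvariantCode T C) :
    7 ∣ #{W : Submodule (ZMod 2) E | W ∈ C ∧ W.map T ≠ W} := by
  have : Fact (Nat.Prime 7) := ⟨by norm_num⟩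
  have hinv : ∀ W : Submodule (ZMod 2) E, W.map T = (W.map T).map T → W = W.map T := fun W hW => by
    rw [← iterate_map_seven h.pow_seven W, Function.iterate_succ_apply,
      Function.iterate_fixed hW.symm, ← hW]
  let f : Function.End {W : Submodule (ZMod 2) E // W ∈ C ∧ W.map T ≠ W} := fun W =>
    ⟨W.1.map T, h.map_mem _ W.2.1, fun hW => W.2.2 (hinv _ hW.symm).symm⟩
  have hval : ∀ (n : ℕ) W, ((f ^ n) W).1 = (Submodule.map T)^[n] W.1 := fun n => by
    induction n with
    | zero => exact fun W => rfl
    | succ n ih => exact fun W => by rw [pow_succ, Function.iterate_succ_apply]; exact ih (f W)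
  have hf : f ^ 7 ^ 1 = 1 := by
    funext W
    exact Subtype.ext ((hval 7 W).trans (iterate_map_seven h.pow_seven W.1))
  have hmod := Equiv.Perm.card_fixedPoints_modEq hf
  have : IsEmpty f.fixedPoints := ⟨fun W => W.1.2.2 (congrArg Subtype.val W.2)⟩
  rw [Fintype.card_subtype, Fintype.card_eq_zero] at hmod
  exact (Nat.modEq_zero_iff_dvd).1 hmod

open Classical in
lemma card_filter_map_eq_le (h : IsInvariantCode T C) :
    #{W : Submodule (ZMod 2) E | W ∈ C ∧ W.map T = W} ≤ 2 := by
  have hone : #{W : Submodule (ZMod 2) E | W ∈ C ∧ W ≤ LinearMap.ker (T - LinearMap.id)} ≤ 1 := by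
    rw [Finset.card_le_one]
    intro W hW W' hW'
    simp only [Finset.mem_filter, Finset.mem_univ, true_and] at hW hW'
    by_contra hne
    have h1 := h.finrank_inf W hW.1 W' hW'.1 hne
    have h2 := two_le_finrank_inf hW.2 hW'.2 (h.finrank_mem W hW.1) (h.finrank_mem W' hW'.1)
      h.finrank_fixed.le
    omega
  calc _ ≤ #(insert (LinearMap.ker (orbitSum T))
        ({W | W ∈ C ∧ W ≤ LinearMap.ker (T - LinearMap.id)} :
          Finset (Submodule (ZMod 2) E))) := by
        refine Finset.card_le_card fun W hW => ?_
        simp only [Finset.mem_filter, Finset.mem_univ, true_and] at hW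
        simp only [Finset.mem_insert, Finset.mem_filter, Finset.mem_univ, true_and]
        exact (h.le_or_eq_of_map_eq hW.1 hW.2).symm.imp_right fun hle => ⟨hW.1, hle⟩
    _ ≤ 2 := (Finset.card_insert_le _ _).trans (by omega)

theorem ncard_le (h : IsInvariantCode T C) : C.ncard ≤ 296 := by
  classical
  have hC : C.ncard = #{W : Submodule (ZMod 2) E | W ∈ C} := by
    rw [← Set.ncard_coe_finset]
    simp
  have hsplit := Finset.card_filter_add_card_filter_not
    (s := {W : Submodule (ZMod 2) E | W ∈ C}) (fun W => W.map T = W)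
  simp only [Finset.filter_filter, ← ne_eq] at hsplit
  have h1 := h.card_filter_map_eq_le
  have h2 := h.card_filter_map_ne_le
  have h3 := h.seven_dvd_card_filter_map_ne
  omega

end IsInvariantCode

end InvariantCode

/-- A `(7,4;3)₂` code invariant under an element of order 7 of `GL(7,F₂)` with
4-dimensional fixed-point space has at most 296 codewords. -/
theorem stmt_18 (M : GL (Fin 7) (ZMod 2)) (hM : orderOf M = 7)
    (hfix : Module.finrank (ZMod 2) (fixedSpace M) = 4)
    (C : Set (Submodule (ZMod 2) V)) (hC : IsCode C)
    (hInv : ∀ W ∈ C, M • W ∈ C) :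
    C.ncard ≤ 296 := by
  have hpow : (Matrix.mulVecLin (M : Matrix (Fin 7) (Fin 7) (ZMod 2))) ^ 7 = 1 := by
    have h1 : (M : Matrix (Fin 7) (Fin 7) (ZMod 2)) ^ 7 = 1 := by
      have h7 : M ^ 7 = 1 := orderOf_dvd_iff_pow_eq_one.1 hM.dvd
      rw [← Units.val_pow_eq_pow_val, h7, Units.val_one]
    rw [← Matrix.toLin'_apply', ← Matrix.toLin'_pow, h1, Matrix.toLin'_one]
    rfl
  exact IsInvariantCode.ncard_le
    { pow_seven := hpow
      finrank_space := by simp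
      finrank_fixed := hfix
      finrank_mem := hC.1
      finrank_inf := hC.2
      map_mem := hInv }
end
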